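/- arXiv:1803.02658 — 2 statements merged into one kernel-verified Lean document; each statement's English description precedes it below -/
import Mathlib

section
/- Let N ≥ 2 and let Ω ⊂ ℝ^N be an open ball. Let c₊, c₋, h : cl(Ω) → ℝ be continuous with c₊ ≥ 0, c₋ ≥ 0 and c₊·c₋ ≡ 0 on Ω, let μ : Ω → ℝ be continuous and bounded, and set Ω₊ := closure of {x ∈ Ω : c₊(x) ≠ 0}. Assume Ω₊ ≠ ∅ and that there exist ε > 0 and μ₁ > 0 such that μ(x) ≥ μ₁ and c₋(x) = 0 for every x ∈ Ω with dist(x, Ω₊) < ε. Let x̄ ∈ Ω₊ ∩ ∂Ω. Then for all real numbers Λ₂ > Λ₁ > 0 there exist R > 0 and M > 0 such that for every λ ∈ [Λ₁, Λ₂], every classical solution u of (P_λ) satisfies sup_{B_R(x̄) ∩ Ω} u ≤ M. -/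
open MeasureTheory Metric Set

/-- The Laplacian of a real-valued function on `ℝ^N`, as the sum of second
partial derivatives in the coordinate directions. -/
noncomputable def lap {N : ℕ} (u : EuclideanSpace ℝ (Fin N) → ℝ)
    (x : EuclideanSpace ℝ (Fin N)) : ℝ :=
  ∑ i : Fin N, fderiv ℝ (fun y => fderiv ℝ u y (EuclideanSpace.single i 1)) x
    (EuclideanSpace.single i 1)

/-- `u` is a classical solution of `(P_lam)` on `Ω`. -/
def IsClassicalSolution {N : ℕ} (Ω : Set (EuclideanSpace ℝ (Fin N)))
    (cp cm h μ : EuclideanSpace ℝ (Fin N) → ℝ) (lam : ℝ)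
    (u : EuclideanSpace ℝ (Fin N) → ℝ) : Prop :=
  ContDiffOn ℝ 2 u Ω ∧ ContinuousOn u (closure Ω) ∧
    (∃ C : ℝ, ∀ x ∈ closure Ω, |u x| ≤ C) ∧
    (∀ x ∈ frontier Ω, u x = 0) ∧
    ∀ x ∈ Ω, -lap u x = (lam * cp x - cm x) * u x + μ x * ‖gradient u x‖ ^ 2 + h x

open scoped Topology

section LaplacianCalculus

variable {N : ℕ}

theorem lap_congr {u v : EuclideanSpace ℝ (Fin N) → ℝ} {x : EuclideanSpace ℝ (Fin N)}
    (h : u =ᶠ[𝓝 x] v) : lap u x = lap v x := by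
  unfold lap
  refine Finset.sum_congr rfl fun i _ => ?_
  have : (fun y => fderiv ℝ u y (EuclideanSpace.single i 1)) =ᶠ[𝓝 x]
      fun y => fderiv ℝ v y (EuclideanSpace.single i 1) := by
    filter_upwards [h.fderiv (𝕜 := ℝ)] with y hy
    rw [hy]
  rw [this.fderiv_eq]

theorem lap_zero (x : EuclideanSpace ℝ (Fin N)) : lap (fun _ => (0 : ℝ)) x = 0 := by
  simp [lap]

theorem norm_gradient_sq (u : EuclideanSpace ℝ (Fin N) → ℝ) (x : EuclideanSpace ℝ (Fin N)) :
    ‖gradient u x‖ ^ 2 = ∑ i : Fin N, fderiv ℝ u x (EuclideanSpace.single i 1) ^ 2 := by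
  rw [EuclideanSpace.real_norm_sq_eq]
  refine Finset.sum_congr rfl fun i _ => ?_
  congr 1
  have h := InnerProductSpace.toDual_symm_apply (𝕜 := ℝ) (y := fderiv ℝ u x)
    (x := EuclideanSpace.single i (1 : ℝ))
  rw [← h]
  rw [EuclideanSpace.inner_single_right]
  simp [gradient]

theorem differentiableAt_fderiv_apply {u : EuclideanSpace ℝ (Fin N) → ℝ}
    {x : EuclideanSpace ℝ (Fin N)} (hu : ContDiffAt ℝ 2 u x) (v : EuclideanSpace ℝ (Fin N)) :
    DifferentiableAt ℝ (fun y => fderiv ℝ u y v) x := by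
  have h1 : ContDiffAt ℝ 1 (fderiv ℝ u) x := hu.fderiv_right (by norm_num)
  exact (h1.differentiableAt (by norm_num)).clm_apply (differentiableAt_const v)

theorem contDiffAt_fderiv_apply {u : EuclideanSpace ℝ (Fin N) → ℝ}
    {x : EuclideanSpace ℝ (Fin N)} (hu : ContDiffAt ℝ 2 u x) (v : EuclideanSpace ℝ (Fin N)) :
    ContDiffAt ℝ 1 (fun y => fderiv ℝ u y v) x :=
  (hu.fderiv_right (by norm_num : (1 : WithTop ℕ∞) + 1 ≤ 2)).clm_apply contDiffAt_const

theorem continuousAt_fderiv_fderiv_apply {u : EuclideanSpace ℝ (Fin N) → ℝ}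
    {x : EuclideanSpace ℝ (Fin N)} (hu : ContDiffAt ℝ 2 u x) (v w : EuclideanSpace ℝ (Fin N)) :
    ContinuousAt (fun z => fderiv ℝ (fun y => fderiv ℝ u y v) z w) x := by
  have h := (contDiffAt_fderiv_apply hu v).fderiv_right
    (m := 0) (by norm_num : (0 : WithTop ℕ∞) + 1 ≤ 1)
  exact h.continuousAt.clm_apply continuousAt_const

theorem continuousAt_lap {u : EuclideanSpace ℝ (Fin N) → ℝ}
    {x : EuclideanSpace ℝ (Fin N)} (hu : ContDiffAt ℝ 2 u x) : ContinuousAt (lap u) x := by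
  unfold lap
  exact tendsto_finsetSum _ fun i _ => continuousAt_fderiv_fderiv_apply hu _ _

/-- Chain rule for the Laplacian of `f ∘ u`. -/
theorem lap_comp {f f' f'' : ℝ → ℝ} (hf : ∀ t, HasDerivAt f (f' t) t)
    (hf' : ∀ t, HasDerivAt f' (f'' t) t) {u : EuclideanSpace ℝ (Fin N) → ℝ}
    {x : EuclideanSpace ℝ (Fin N)} (hu : ContDiffAt ℝ 2 u x) :
    lap (fun y => f (u y)) x = f' (u x) * lap u x + f'' (u x) * ‖gradient u x‖ ^ 2 := by
  rw [norm_gradient_sq]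
  unfold lap
  rw [Finset.mul_sum, Finset.mul_sum, ← Finset.sum_add_distrib]
  refine Finset.sum_congr rfl fun i _ => ?_
  set e : EuclideanSpace ℝ (Fin N) := EuclideanSpace.single i 1
  have hev : (fun y => fderiv ℝ (fun y => f (u y)) y e) =ᶠ[𝓝 x]
      fun y => f' (u y) * fderiv ℝ u y e := by
    have h2 : ∀ᶠ y in 𝓝 x, ContDiffAt ℝ 2 u y := hu.eventually (by simp)
    filter_upwards [h2] with y hy
    have hd := (hy.differentiableAt (by norm_num)).hasFDerivAt
    have := (hf (u y)).comp_hasFDerivAt y hd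
    rw [show (fun y => f (u y)) = f ∘ u from rfl, this.fderiv]
    simp
  rw [hev.fderiv_eq]
  have hd := (hu.differentiableAt (by norm_num)).hasFDerivAt
  have h1 : HasFDerivAt (fun y => f' (u y)) (f'' (u x) • fderiv ℝ u x) x :=
    (hf' (u x)).comp_hasFDerivAt x hd
  have h2 := (differentiableAt_fderiv_apply hu e).hasFDerivAt
  rw [show (fun y => f' (u y) * fderiv ℝ u y e) = (fun y => f' (u y)) * fun y => fderiv ℝ u y e from
    rfl, (h1.mul h2).fderiv]
  simp only [add_apply, smul_apply, smul_eq_mul]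
  ring

end LaplacianCalculus

section PositivePart

theorem hasDerivAt_max_zero_pow (n : ℕ) (t : ℝ) :
    HasDerivAt (fun t : ℝ => max t 0 ^ (n + 2)) ((n + 2) * max t 0 ^ (n + 1)) t := by
  rcases lt_trichotomy t 0 with ht | rfl | ht
  · have : (fun t : ℝ => max t 0 ^ (n + 2)) =ᶠ[𝓝 t] fun _ => 0 := by
      filter_upwards [Iio_mem_nhds ht] with s hs
      simp [max_eq_right (le_of_lt (mem_Iio.1 hs))]
    simpa [max_eq_right ht.le] using (hasDerivAt_const t (0 : ℝ)).congr_of_eventuallyEq this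
  · simp only [max_self, ne_eq, Nat.add_eq_zero_iff, one_ne_zero, and_false, not_false_eq_true,
      zero_pow, mul_zero]
    rw [hasDerivAt_iff_isLittleO_nhds_zero]
    simp only [zero_add, max_self, ne_eq, Nat.add_eq_zero_iff, OfNat.ofNat_ne_zero, and_false,
      not_false_eq_true, zero_pow, sub_zero, smul_zero]
    have h1 : (fun h : ℝ => max h 0 ^ (n + 2)) =O[𝓝 0] fun h : ℝ => h ^ (n + 2) := by
      refine Asymptotics.IsBigO.of_bound 1 (Filter.Eventually.of_forall fun h => ?_)
      rw [one_mul, norm_pow, norm_pow]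
      gcongr
      rcases le_total h 0 with hh | hh <;> simp [hh]
    have h2 : (fun h : ℝ => h ^ (n + 2)) =o[𝓝 0] fun h : ℝ => h ^ 1 :=
      Asymptotics.isLittleO_pow_pow (by omega)
    simpa using h1.trans_isLittleO h2
  · have : (fun t : ℝ => max t 0 ^ (n + 2)) =ᶠ[𝓝 t] fun t => t ^ (n + 2) := by
      filter_upwards [Ioi_mem_nhds ht] with s hs
      simp [max_eq_left (le_of_lt (mem_Ioi.1 hs))]
    have h2 := (hasDerivAt_pow (n + 2) t).congr_of_eventuallyEq this
    simpa [max_eq_left ht.le] using h2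

theorem contDiff_max_zero_pow (n : ℕ) : ContDiff ℝ 2 (fun t : ℝ => max t 0 ^ (n + 3)) := by
  have d1 : deriv (fun t : ℝ => max t 0 ^ (n + 3)) =
      fun t => ((n + 1 : ℕ) + 2 : ℝ) * max t 0 ^ (n + 2) :=
    funext fun t => (hasDerivAt_max_zero_pow (n + 1) t).deriv
  have d2 : deriv (fun t : ℝ => max t 0 ^ (n + 2)) = fun t => (n + 2 : ℝ) * max t 0 ^ (n + 1) :=
    funext fun t => (hasDerivAt_max_zero_pow n t).deriv
  have c1 : ContDiff ℝ 1 (fun t : ℝ => max t 0 ^ (n + 2)) := by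
    rw [contDiff_one_iff_deriv, d2]
    exact ⟨fun t => (hasDerivAt_max_zero_pow n t).differentiableAt, by fun_prop⟩
  rw [show (2 : WithTop ℕ∞) = 1 + 1 by norm_num, contDiff_succ_iff_deriv, d1]
  exact ⟨fun t => (hasDerivAt_max_zero_pow (n + 1) t).differentiableAt, by simp,
    contDiff_const.mul c1⟩

end PositivePart

section Green

variable {N : ℕ}

theorem continuous_mul_of_tsupport_subset {Ω : Set (EuclideanSpace ℝ (Fin N))} (hΩ : IsOpen Ω)
    {ψ f : EuclideanSpace ℝ (Fin N) → ℝ} (hψ : Continuous ψ) (hsub : tsupport ψ ⊆ Ω)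
    (hf : ContinuousOn f Ω) : Continuous fun x => ψ x * f x := by
  rw [continuous_iff_continuousAt]
  intro x
  by_cases hx : x ∈ Ω
  · exact hψ.continuousAt.mul (hf.continuousAt (hΩ.mem_nhds hx))
  · have h0 : ψ =ᶠ[𝓝 x] 0 := notMem_tsupport_iff_eventuallyEq.1 fun h => hx (hsub h)
    have : (fun x => ψ x * f x) =ᶠ[𝓝 x] fun _ => 0 := by
      filter_upwards [h0] with y hy
      simp [hy]
    exact continuousAt_const.congr this.symm

theorem integrable_mul_of_tsupport_subset {Ω : Set (EuclideanSpace ℝ (Fin N))} (hΩ : IsOpen Ω)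
    {ψ f : EuclideanSpace ℝ (Fin N) → ℝ} (hψ : Continuous ψ) (hc : HasCompactSupport ψ)
    (hsub : tsupport ψ ⊆ Ω) (hf : ContinuousOn f Ω) : Integrable fun x => ψ x * f x :=
  (continuous_mul_of_tsupport_subset hΩ hψ hsub hf).integrable_of_hasCompactSupport hc.mul_right

/-- Green's second identity against a compactly supported function. -/
theorem integral_mul_lap_comm {Ω : Set (EuclideanSpace ℝ (Fin N))} (hΩ : IsOpen Ω)
    {ϕ u : EuclideanSpace ℝ (Fin N) → ℝ} (hϕ : ContDiff ℝ 2 ϕ) (hc : HasCompactSupport ϕ)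
    (hsub : tsupport ϕ ⊆ Ω) (hu : ContDiffOn ℝ 2 u Ω) :
    Integrable (fun x => ϕ x * lap u x) ∧ Integrable (fun x => lap ϕ x * u x) ∧
      ∫ x, ϕ x * lap u x = ∫ x, lap ϕ x * u x := by
  have huA : ∀ x ∈ Ω, ContDiffAt ℝ 2 u x := fun x hx => hu.contDiffAt (hΩ.mem_nhds hx)
  set e : Fin N → EuclideanSpace ℝ (Fin N) := fun i => EuclideanSpace.single i 1 with he
  have hϕ1 : ∀ i, ContDiff ℝ 1 fun x => fderiv ℝ ϕ x (e i) := fun i =>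
    contDiff_iff_contDiffAt.2 fun x => contDiffAt_fderiv_apply hϕ.contDiffAt _
  have c1 : ∀ i, HasCompactSupport fun x => fderiv ℝ ϕ x (e i) := fun i => hc.fderiv_apply ℝ (e i)
  have s1 : ∀ i, tsupport (fun x => fderiv ℝ ϕ x (e i)) ⊆ Ω := fun i =>
    (tsupport_fderiv_apply_subset ℝ (e i)).trans hsub
  have c2 : ∀ i, HasCompactSupport fun x => fderiv ℝ (fun y => fderiv ℝ ϕ y (e i)) x (e i) :=
    fun i => (c1 i).fderiv_apply ℝ (e i)
  have s2 : ∀ i, tsupport (fun x => fderiv ℝ (fun y => fderiv ℝ ϕ y (e i)) x (e i)) ⊆ Ω :=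
    fun i => (tsupport_fderiv_apply_subset ℝ (e i)).trans (s1 i)
  have k2 : ∀ i, Continuous fun x => fderiv ℝ (fun y => fderiv ℝ ϕ y (e i)) x (e i) := fun i =>
    continuous_iff_continuousAt.2 fun x => continuousAt_fderiv_fderiv_apply hϕ.contDiffAt _ _
  have u0 : ContinuousOn u Ω := hu.continuousOn
  have u1 : ∀ i, ContinuousOn (fun x => fderiv ℝ u x (e i)) Ω := fun i x hx =>
    (contDiffAt_fderiv_apply (huA x hx) _).continuousAt.continuousWithinAt
  have u2 : ∀ i, ContinuousOn (fun x => fderiv ℝ (fun y => fderiv ℝ u y (e i)) x (e i)) Ω :=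
    fun i x hx => (continuousAt_fderiv_fderiv_apply (huA x hx) _ _).continuousWithinAt
  have i1 : ∀ i, Integrable fun x => ϕ x * fderiv ℝ (fun y => fderiv ℝ u y (e i)) x (e i) :=
    fun i => integrable_mul_of_tsupport_subset hΩ hϕ.continuous hc hsub (u2 i)
  have i2 : ∀ i, Integrable fun x => fderiv ℝ (fun y => fderiv ℝ ϕ y (e i)) x (e i) * u x :=
    fun i => integrable_mul_of_tsupport_subset hΩ (k2 i) (c2 i) (s2 i) u0
  have i3 : ∀ i, Integrable fun x => fderiv ℝ ϕ x (e i) * fderiv ℝ u x (e i) := fun i =>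
    integrable_mul_of_tsupport_subset hΩ (hϕ1 i).continuous (c1 i) (s1 i) (u1 i)
  have i4 : ∀ i, Integrable fun x => ϕ x * fderiv ℝ u x (e i) := fun i =>
    integrable_mul_of_tsupport_subset hΩ hϕ.continuous hc hsub (u1 i)
  have i5 : ∀ i, Integrable fun x => fderiv ℝ ϕ x (e i) * u x := fun i =>
    integrable_mul_of_tsupport_subset hΩ (hϕ1 i).continuous (c1 i) (s1 i) u0
  have key : ∀ i, ∫ x, ϕ x * fderiv ℝ (fun y => fderiv ℝ u y (e i)) x (e i) =
      ∫ x, fderiv ℝ (fun y => fderiv ℝ ϕ y (e i)) x (e i) * u x := by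
    intro i
    rw [integral_mul_fderiv_eq_neg_fderiv_mul_of_integrable (i3 i) (i1 i) (i4 i)
      (fun x _ => hϕ.differentiable (by norm_num) x)
      (fun x hx => differentiableAt_fderiv_apply (huA x (hsub hx)) _),
      integral_mul_fderiv_eq_neg_fderiv_mul_of_integrable (i2 i) (i3 i) (i5 i)
      (fun x _ => (hϕ1 i).differentiable (by norm_num) x)
      (fun x hx => (huA x (s1 i hx)).differentiableAt (by norm_num)), neg_neg]
  have e1 : (fun x => ϕ x * lap u x) =
      fun x => ∑ i, ϕ x * fderiv ℝ (fun y => fderiv ℝ u y (e i)) x (e i) := by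
    funext x; simp only [lap, Finset.mul_sum, he]
  have e2 : (fun x => lap ϕ x * u x) =
      fun x => ∑ i, fderiv ℝ (fun y => fderiv ℝ ϕ y (e i)) x (e i) * u x := by
    funext x; simp only [lap, Finset.sum_mul, he]
  rw [e1, e2]
  refine ⟨integrable_finsetSum _ fun i _ => i1 i, integrable_finsetSum _ fun i _ => i2 i, ?_⟩
  rw [integral_finsetSum _ fun i _ => i1 i, integral_finsetSum _ fun i _ => i2 i]
  exact Finset.sum_congr rfl fun i _ => key i

end Green

section MeanValue

variable {N : ℕ}

theorem hasFDerivAt_max_one_sub_norm_sq_pow (n : ℕ) (y : EuclideanSpace ℝ (Fin N)) :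
    HasFDerivAt (fun y : EuclideanSpace ℝ (Fin N) => max (1 - ‖y‖ ^ 2) 0 ^ (n + 2))
      ((-2 * ((n : ℝ) + 2) * max (1 - ‖y‖ ^ 2) 0 ^ (n + 1) : ℝ) • innerSL ℝ y) y := by
  have h1 : HasFDerivAt (fun y : EuclideanSpace ℝ (Fin N) => 1 - ‖y‖ ^ 2) (-(2 • innerSL ℝ y)) y :=
    (hasStrictFDerivAt_norm_sq y).hasFDerivAt.const_sub 1
  have := (hasDerivAt_max_zero_pow n (1 - ‖y‖ ^ 2)).comp_hasFDerivAt y h1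
  refine this.congr_fderiv ?_
  ext v
  simp
  ring

theorem hasCompactSupport_max_one_sub_norm_sq_pow (n : ℕ) :
    HasCompactSupport fun y : EuclideanSpace ℝ (Fin N) => max (1 - ‖y‖ ^ 2) 0 ^ (n + 1) := by
  refine HasCompactSupport.intro (isCompact_closedBall 0 1) fun y hy => ?_
  have : 1 < ‖y‖ := by simpa using hy
  rw [max_eq_right (by nlinarith)]
  simp

/-- The derivative of a weighted ball average of `V` with respect to the radius. -/
theorem hasDerivAt_radial_average {V : EuclideanSpace ℝ (Fin N) → ℝ} (hV : ContDiff ℝ 2 V)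
    (hc : HasCompactSupport V) (x₁ : EuclideanSpace ℝ (Fin N)) (t : ℝ) :
    HasDerivAt (fun t : ℝ => ∫ y, V (x₁ + t • y) * max (1 - ‖y‖ ^ 2) 0 ^ 2)
      (t * ∫ y, max (1 - ‖y‖ ^ 2) 0 ^ 3 / 6 * lap V (x₁ + t • y)) t := by
  set η : EuclideanSpace ℝ (Fin N) → ℝ := fun y => max (1 - ‖y‖ ^ 2) 0 ^ 2 with hη
  set ζ : EuclideanSpace ℝ (Fin N) → ℝ := fun y => max (1 - ‖y‖ ^ 2) 0 ^ 3 / 6 with hζ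
  have ηc : Continuous η := by fun_prop
  have ζc : Continuous ζ := by fun_prop
  have ηs : HasCompactSupport η := hasCompactSupport_max_one_sub_norm_sq_pow 1
  have ζs : HasCompactSupport ζ := by
    refine HasCompactSupport.intro (isCompact_closedBall 0 1) fun y hy => ?_
    have : 1 < ‖y‖ := by simpa using hy
    simp only [hζ]
    rw [max_eq_right (by nlinarith)]
    simp
  have η0 : ∀ y, 0 ≤ η y := fun y => by positivity
  have Vc := hV.continuous
  have V1c : Continuous (fderiv ℝ V) := hV.continuous_fderiv (by norm_num)
  have hdζ : ∀ y, HasFDerivAt ζ ((-η y) • innerSL ℝ y) y := by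
    intro y
    have := (hasFDerivAt_max_one_sub_norm_sq_pow 1 y).mul_const (1 / 6 : ℝ)
    refine (this.congr_fderiv ?_).congr_of_eventuallyEq
      (Filter.Eventually.of_forall fun z => ?_)
    · ext v
      simp [hη]
      ring
    · simp [hζ]
      ring
  obtain ⟨C, hC⟩ := V1c.bounded_above_of_compact_support (hc.fderiv ℝ)
  have hint : ∀ (f : EuclideanSpace ℝ (Fin N) → ℝ), Continuous f →
      Integrable fun y => f y * η y := fun f hf =>
    (hf.mul ηc).integrable_of_hasCompactSupport ηs.mul_left
  have hmain := (hasDerivAt_integral_of_dominated_loc_of_deriv_le (μ := volume) (s := univ)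
    (F := fun (t : ℝ) y => V (x₁ + t • y) * η y)
    (F' := fun (t : ℝ) y => fderiv ℝ V (x₁ + t • y) y * η y) (x₀ := t)
    (bound := fun y => C * ‖y‖ * η y) Filter.univ_mem
    (Filter.Eventually.of_forall fun s => (hint _ (by fun_prop)).aestronglyMeasurable)
    (hint _ (by fun_prop)) (hint _ (by fun_prop)).aestronglyMeasurable
    (Filter.Eventually.of_forall fun y s _ => by
      rw [norm_mul, Real.norm_of_nonneg (η0 y)]
      refine mul_le_mul_of_nonneg_right ?_ (η0 y)
      exact (ContinuousLinearMap.le_opNorm _ _).trans (by gcongr; exact hC _))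
    (hint _ (by fun_prop))
    (Filter.Eventually.of_forall fun y s _ => by
      refine HasDerivAt.mul_const ?_ _
      have h1 : HasDerivAt (fun s : ℝ => x₁ + s • y) y s := by
        simpa using ((hasDerivAt_id s).smul_const y).const_add x₁
      exact ((hV.differentiable (by norm_num) _).hasFDerivAt).comp_hasDerivAt s h1)).2
  refine hmain.congr_deriv ?_
  set e : Fin N → EuclideanSpace ℝ (Fin N) := fun i => EuclideanSpace.single i 1 with he
  set W : Fin N → EuclideanSpace ℝ (Fin N) → ℝ :=
    fun i y => fderiv ℝ V (x₁ + t • y) (e i) with hW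
  have hVi : ∀ i, ContDiff ℝ 1 fun x => fderiv ℝ V x (e i) := fun i =>
    contDiff_iff_contDiffAt.2 fun x => contDiffAt_fderiv_apply hV.contDiffAt _
  have hWc : ∀ i, Continuous (W i) := fun i => by fun_prop
  have hdW : ∀ i y, HasFDerivAt (W i)
      (t • fderiv ℝ (fun x => fderiv ℝ V x (e i)) (x₁ + t • y)) y := by
    intro i y
    have h1 : HasFDerivAt (fun y : EuclideanSpace ℝ (Fin N) => x₁ + t • y)
        (t • ContinuousLinearMap.id ℝ (EuclideanSpace ℝ (Fin N))) y :=
      ((hasFDerivAt_id y).const_smul t).const_add x₁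
    have h2 := ((hVi i).differentiable (by norm_num) (x₁ + t • y)).hasFDerivAt.comp y h1
    refine h2.congr_fderiv ?_
    ext v
    simp
  have k2 : ∀ i, Continuous fun x => fderiv ℝ (fun y => fderiv ℝ V y (e i)) x (e i) := fun i =>
    continuous_iff_continuousAt.2 fun x => continuousAt_fderiv_fderiv_apply hV.contDiffAt _ _
  have dζ : ∀ i y, fderiv ℝ ζ y (e i) = -(η y * y i) := by
    intro i y
    rw [(hdζ y).fderiv]
    simp [he, EuclideanSpace.inner_single_right]
  have dW : ∀ i y, fderiv ℝ (W i) y (e i) =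
      t * fderiv ℝ (fun x => fderiv ℝ V x (e i)) (x₁ + t • y) (e i) := by
    intro i y
    rw [(hdW i y).fderiv]
    simp
  have k2' : ∀ i, Continuous fun y =>
      fderiv ℝ (fun x => fderiv ℝ V x (e i)) (x₁ + t • y) (e i) := fun i =>
    (k2 i).comp (by fun_prop : Continuous fun y : EuclideanSpace ℝ (Fin N) => x₁ + t • y)
  have j1 : ∀ i, Integrable fun y => fderiv ℝ ζ y (e i) * W i y := by
    intro i
    simp_rw [dζ]
    have := hint (fun y => -(y i * W i y)) (by fun_prop)
    refine this.congr (Filter.Eventually.of_forall fun y => ?_)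
    simp only
    ring
  have j2 : ∀ i, Integrable fun y => ζ y * fderiv ℝ (W i) y (e i) := by
    intro i
    simp_rw [dW]
    exact (ζc.mul (continuous_const.mul (k2' i))).integrable_of_hasCompactSupport ζs.mul_right
  have j3 : ∀ i, Integrable fun y => ζ y * W i y := fun i =>
    (ζc.mul (hWc i)).integrable_of_hasCompactSupport ζs.mul_right
  have parts : ∀ i, ∫ y, ζ y * fderiv ℝ (W i) y (e i) = ∫ y, η y * y i * W i y := by
    intro i
    rw [integral_mul_fderiv_eq_neg_fderiv_mul_of_integrable (j1 i) (j2 i) (j3 i)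
      (fun y _ => (hdζ y).differentiableAt) (fun y _ => (hdW i y).differentiableAt),
      ← integral_neg]
    refine integral_congr_ae (Filter.Eventually.of_forall fun y => ?_)
    simp only [dζ]
    ring
  have l1 : (fun y => fderiv ℝ V (x₁ + t • y) y * η y) =
      fun y => ∑ i, η y * y i * W i y := by
    funext y
    have hy : y = ∑ i, y i • e i := by
      ext j
      simp [he, Finset.sum_apply, Pi.single_apply]
    have key : ∀ L : EuclideanSpace ℝ (Fin N) →L[ℝ] ℝ, L y = ∑ i, y i * L (e i) := by
      intro L
      conv_lhs => rw [hy]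
      simp [map_sum]
    rw [key, Finset.sum_mul]
    refine Finset.sum_congr rfl fun i _ => ?_
    simp only [hW]
    ring
  have l2 : ∀ y, t * (ζ y * lap V (x₁ + t • y)) = ∑ i, ζ y * fderiv ℝ (W i) y (e i) := by
    intro y
    simp_rw [dW, lap, Finset.mul_sum]
    refine Finset.sum_congr rfl fun i _ => ?_
    simp only [he]
    ring
  have l3 : ∫ y, t * (ζ y * lap V (x₁ + t • y)) = ∫ y, ∑ i, ζ y * fderiv ℝ (W i) y (e i) := by
    simp_rw [l2]
  rw [l1, ← integral_const_mul]
  refine Eq.trans ?_ l3.symm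
  rw [integral_finsetSum _ fun i _ => j2 i, integral_finsetSum]
  · exact Finset.sum_congr rfl fun i _ => (parts i).symm
  · intro i _
    have := (j1 i).neg
    refine this.congr (Filter.Eventually.of_forall fun y => ?_)
    simp only [dζ, Pi.neg_apply]
    ring

/-- A sub-mean-value inequality for functions whose Laplacian is bounded below. -/
theorem exists_sub_mean_value (N : ℕ) : ∃ a b : ℝ, 0 < a ∧ 0 < b ∧
    ∀ V : EuclideanSpace ℝ (Fin N) → ℝ, ContDiff ℝ 2 V → HasCompactSupport V → (∀ x, 0 ≤ V x) →
    ∀ (x₁ : EuclideanSpace ℝ (Fin N)) (s K : ℝ), 0 < s →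
      (∀ x ∈ ball x₁ s, -K ≤ lap V x) →
      a * s ^ N * V x₁ ≤ (∫ x in ball x₁ s, V x) + b * K * s ^ 2 * s ^ N := by
  set η : EuclideanSpace ℝ (Fin N) → ℝ := fun y => max (1 - ‖y‖ ^ 2) 0 ^ 2 with hη
  set ζ : EuclideanSpace ℝ (Fin N) → ℝ := fun y => max (1 - ‖y‖ ^ 2) 0 ^ 3 / 6 with hζ
  have ηc : Continuous η := by fun_prop
  have ζc : Continuous ζ := by fun_prop
  have ηs : HasCompactSupport η := hasCompactSupport_max_one_sub_norm_sq_pow 1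
  have ζs : HasCompactSupport ζ := by
    refine HasCompactSupport.intro (isCompact_closedBall 0 1) fun y hy => ?_
    have : 1 < ‖y‖ := by simpa using hy
    simp only [hζ]
    rw [max_eq_right (by nlinarith)]
    simp
  have η0 : ∀ y, 0 ≤ η y := fun y => by positivity
  have ζ0 : ∀ y, 0 ≤ ζ y := fun y => by positivity
  have Iη : 0 < ∫ y, η y :=
    ηc.integral_pos_of_hasCompactSupport_nonneg_nonzero ηs η0 (x := 0) (by simp [hη])
  have Iζ : 0 < ∫ y, ζ y :=
    ζc.integral_pos_of_hasCompactSupport_nonneg_nonzero ζs ζ0 (x := 0) (by simp [hζ])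
  refine ⟨∫ y, η y, (∫ y, ζ y) / 2, Iη, by positivity, ?_⟩
  intro V hV hc hV0 x₁ s K hs hlap
  have lapc : Continuous (lap V) := continuous_iff_continuousAt.2 fun x =>
    continuousAt_lap hV.contDiffAt
  set Φ : ℝ → ℝ := fun t => ∫ y, V (x₁ + t • y) * η y with hΦ
  have hder : ∀ t, HasDerivAt (fun t => Φ t + K * (∫ y, ζ y) * (t ^ 2 / 2))
      (t * (∫ y, ζ y * lap V (x₁ + t • y)) + K * (∫ y, ζ y) * t) t := by
    intro t
    have h2 : HasDerivAt (fun t : ℝ => t ^ 2 / 2) t t := by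
      simpa using (hasDerivAt_pow 2 t).div_const 2
    exact (hasDerivAt_radial_average hV hc x₁ t).add (h2.const_mul _)
  have hmono : MonotoneOn (fun t => Φ t + K * (∫ y, ζ y) * (t ^ 2 / 2)) (Icc 0 s) := by
    refine monotoneOn_of_deriv_nonneg (convex_Icc 0 s)
      (fun t _ => (hder t).continuousAt.continuousWithinAt)
      (fun t _ => (hder t).differentiableAt.differentiableWithinAt) fun t ht => ?_
    rw [interior_Icc] at ht
    rw [(hder t).deriv]
    have : -K * ∫ y, ζ y ≤ ∫ y, ζ y * lap V (x₁ + t • y) := by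
      rw [← integral_const_mul]
      refine integral_mono
        ((continuous_const.mul ζc).integrable_of_hasCompactSupport ζs.mul_left)
        ((ζc.mul (lapc.comp (by fun_prop))).integrable_of_hasCompactSupport ζs.mul_right)
        fun y => ?_
      by_cases hy : ‖y‖ < 1
      · have hmem : x₁ + t • y ∈ ball x₁ s := by
          rw [mem_ball, dist_eq_norm, add_sub_cancel_left, norm_smul, Real.norm_of_nonneg ht.1.le]
          nlinarith [ht.1, ht.2, norm_nonneg y]
        have := mul_le_mul_of_nonneg_left (hlap _ hmem) (ζ0 y)
        simp only
        linarith
      · have : ζ y = 0 := by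
          simp only [hζ]
          rw [max_eq_right (by nlinarith [norm_nonneg y])]
          simp
        simp [this]
    nlinarith [ht.1]
  have h0s := hmono (left_mem_Icc.2 hs.le) (right_mem_Icc.2 hs.le) hs.le
  have hΦ0 : Φ 0 = V x₁ * ∫ y, η y := by
    simp [hΦ, integral_const_mul]
  have hΦs : s ^ N * Φ s ≤ ∫ x in ball x₁ s, V x := by
    set G : EuclideanSpace ℝ (Fin N) → ℝ := (ball x₁ s).indicator V with hG
    have hGi : Integrable G :=
      (hV.continuous.integrable_of_hasCompactSupport hc).indicator measurableSet_ball
    have hGt : Integrable fun y => G (x₁ + y) := hGi.comp_add_left x₁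
    have hGs : Integrable fun y : EuclideanSpace ℝ (Fin N) => G (x₁ + s • y) :=
      hGt.comp_smul (R := s) hs.ne'
    have h1 : Φ s ≤ ∫ y, G (x₁ + s • y) := by
      refine integral_mono
        (((hV.continuous.comp (by fun_prop : Continuous fun y : EuclideanSpace ℝ (Fin N) =>
          x₁ + s • y)).mul ηc).integrable_of_hasCompactSupport ηs.mul_left) hGs fun y => ?_
      have hmem : x₁ + s • y ∈ ball x₁ s ↔ ‖y‖ < 1 := by
        rw [mem_ball, dist_eq_norm, add_sub_cancel_left, norm_smul, Real.norm_of_nonneg hs.le]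
        exact ⟨fun h => by by_contra hh; nlinarith, fun h => by nlinarith⟩
      by_cases hy : ‖y‖ < 1
      · simp only [hG, indicator_of_mem (hmem.2 hy)]
        refine mul_le_of_le_one_right (hV0 _) ?_
        refine pow_le_one₀ (le_max_right _ _) (max_le ?_ zero_le_one)
        nlinarith [norm_nonneg y]
      · have : η y = 0 := by
          simp only [hη]
          rw [max_eq_right (by nlinarith [norm_nonneg y])]
          simp
        simp only [this, mul_zero]
        exact indicator_nonneg (fun x _ => hV0 x) _
    have h2 : ∫ y, G (x₁ + s • y) = (s ^ N)⁻¹ * ∫ x in ball x₁ s, V x := by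
      rw [Measure.integral_comp_smul volume (fun y => G (x₁ + y)) s, integral_add_left_eq_self G x₁,
        hG, integral_indicator measurableSet_ball]
      simp [abs_of_pos hs]
    rw [h2] at h1
    have hsN : 0 < s ^ N := by positivity
    calc s ^ N * Φ s ≤ s ^ N * ((s ^ N)⁻¹ * ∫ x in ball x₁ s, V x) := by gcongr
      _ = ∫ x in ball x₁ s, V x := by field_simp
  simp only [hΦ0] at h0s
  have hsN : 0 < s ^ N := by positivity
  have := mul_le_mul_of_nonneg_left h0s hsN.le
  nlinarith

end MeanValue

section WeightedBound

variable {N : ℕ}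

/-- Truncating a barrier that is nonpositive on the frontier gives a test function. -/
theorem contDiff_indicator_max_sub_pow {E : Set (EuclideanSpace ℝ (Fin N))} (hE : IsOpen E)
    (hb : Bornology.IsBounded E) {g : EuclideanSpace ℝ (Fin N) → ℝ} (hg : ContDiff ℝ 2 g)
    (hfr : ∀ x ∈ frontier E, g x ≤ 0) {δ : ℝ} (hδ : 0 < δ) (n : ℕ) :
    ContDiff ℝ 2 (E.indicator fun x => max (g x - δ) 0 ^ (n + 3)) ∧
      HasCompactSupport (E.indicator fun x => max (g x - δ) 0 ^ (n + 3)) ∧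
      tsupport (E.indicator fun x => max (g x - δ) 0 ^ (n + 3)) ⊆ E := by
  set ϕ := E.indicator fun x => max (g x - δ) 0 ^ (n + 3) with hϕ
  have hloc : ∀ x ∉ E, ϕ =ᶠ[𝓝 x] 0 := by
    intro x hx
    by_cases hxc : x ∈ closure E
    · have hgx : g x ≤ 0 := hfr x (by rw [hE.frontier_eq]; exact ⟨hxc, hx⟩)
      filter_upwards [hg.continuous.continuousAt.eventually (gt_mem_nhds (hgx.trans_lt hδ))]
        with y hy
      simp only [hϕ, indicator]
      split_ifs
      · rw [max_eq_right (by linarith)]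
        simp
      · rfl
    · filter_upwards [isClosed_closure.isOpen_compl.mem_nhds hxc] with y hy
      simp only [hϕ, Pi.zero_apply]
      exact indicator_of_notMem (fun h => hy (subset_closure h)) _
  refine ⟨contDiff_iff_contDiffAt.2 fun x => ?_, ?_, ?_⟩
  · by_cases hx : x ∈ E
    · have h1 : ContDiff ℝ 2 fun x => max (g x - δ) 0 ^ (n + 3) :=
        (contDiff_max_zero_pow n).comp (hg.sub contDiff_const)
      refine h1.contDiffAt.congr_of_eventuallyEq ?_
      filter_upwards [hE.mem_nhds hx] with y hy
      simp [hϕ, hy]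
    · exact contDiffAt_const.congr_of_eventuallyEq (hloc x hx)
  · refine HasCompactSupport.of_support_subset_isCompact hb.isCompact_closure ?_
    exact (support_indicator_subset).trans subset_closure
  · intro x hx
    by_contra hxE
    exact notMem_tsupport_iff_eventuallyEq.2 (hloc x hxE) hx

theorem neg_one_le_exp_mul_self (t : ℝ) : -1 ≤ Real.exp t * t := by
  have h1 : -t ≤ Real.exp (-t) := by linarith [Real.add_one_le_exp (-t)]
  have h2 : Real.exp t * Real.exp (-t) = 1 := by rw [← Real.exp_add]; simp
  nlinarith [Real.exp_pos t, mul_le_mul_of_nonneg_left h1 (Real.exp_pos t).le]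

theorem neg_le_exp_mul_linear {α β : ℝ} (hα : 0 < α) (hβ : 0 ≤ β) (t : ℝ) :
    -(α + β * Real.exp (β / α)) ≤ Real.exp t * (α * t - β) := by
  have hp : 0 < Real.exp (β / α) := Real.exp_pos _
  rcases le_total β (α * t) with h | h
  · have : 0 ≤ Real.exp t * (α * t - β) := mul_nonneg (Real.exp_pos t).le (by linarith)
    have : 0 ≤ β * Real.exp (β / α) := by positivity
    linarith
  · have h1 : Real.exp t ≤ Real.exp (β / α) := by
      gcongr
      rw [le_div_iff₀ hα]
      linarith
    have h2 := neg_one_le_exp_mul_self t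
    nlinarith

theorem mul_pow_le_of_gradient_bound {n : ℕ} {c CL G κ w L D : ℝ} (hc : 0 < c) (hκ : 0 ≤ κ)
    (hw : 0 ≤ w) (hwG : w ≤ G) (hL : -CL ≤ L) (hD : c * w ≤ D) (hn : CL + κ * G ≤ n * c) :
    κ * w ^ (n + 3) ≤ (n + 3) * w ^ (n + 2) * L + (n + 3) * (n + 2) * w ^ (n + 1) * D := by
  have h1 := mul_le_mul_of_nonneg_left hL (by positivity : 0 ≤ (n + 3) * w ^ (n + 2))
  have h3 := mul_le_mul_of_nonneg_left hD (by positivity : 0 ≤ (n + 3) * (n + 2) * w ^ (n + 1))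
  have h4 : (n + 3) * w ^ (n + 2) * (CL + κ * w) ≤ (n + 3) * w ^ (n + 2) * ((n + 2) * c) := by
    gcongr
    have : κ * w ≤ κ * G := by gcongr
    linarith
  have h5 : κ * w ^ (n + 3) ≤ (n + 3) * w ^ (n + 2) * (κ * w) := by
    have : 0 ≤ κ * w ^ (n + 3) := by positivity
    calc κ * w ^ (n + 3) ≤ (n + 3) * (κ * w ^ (n + 3)) := by
          nlinarith [(Nat.cast_nonneg n : (0 : ℝ) ≤ n)]
      _ = _ := by ring
  have h6 : (n + 3) * (n + 2) * w ^ (n + 1) * (c * w) =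
      (n + 3) * w ^ (n + 2) * ((n + 2) * c) := by ring
  linarith

set_option maxHeartbeats 1000000 in
/-- A weighted integral bound for exponentials of supersolutions of a linear inequality with
natural growth in the gradient, with the weight given by powers of a barrier `g`. -/
theorem exists_integral_exp_mul_le {E S : Set (EuclideanSpace ℝ (Fin N))} (hE : IsOpen E)
    (hb : Bornology.IsBounded E) {g : EuclideanSpace ℝ (Fin N) → ℝ} (hg : ContDiff ℝ 2 g)
    (hfr : ∀ x ∈ frontier E, g x ≤ 0) (hpos : ∀ x ∈ E, 0 ≤ g x) {c g₀ : ℝ} (hc : 0 < c)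
    (hg₀ : 0 < g₀) (hgrad : ∀ x ∈ E, x ∉ S → c * g x ≤ ‖gradient g x‖ ^ 2)
    (hS : ∀ x ∈ S, g₀ ≤ g x) {μ₁ b₀ Cb H : ℝ} (hμ₁ : 0 < μ₁) (hb₀ : 0 < b₀) (hH : 0 ≤ H) :
    ∃ (k : ℕ) (C₀ : ℝ), ∀ δ, 0 < δ → δ ≤ g₀ / 2 → ∀ u : EuclideanSpace ℝ (Fin N) → ℝ,
      ContDiffOn ℝ 2 u E →
      (∀ x ∈ E, ∃ b h : ℝ, 0 ≤ b ∧ b ≤ Cb ∧ |h| ≤ H ∧ (x ∈ S → b₀ ≤ b) ∧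
        lap u x + μ₁ * ‖gradient u x‖ ^ 2 ≤ -(b * u x + h)) →
      Integrable (E.indicator fun x => Real.exp (μ₁ * u x) * max (g x - δ) 0 ^ k) ∧
      ∫ x, E.indicator (fun x => Real.exp (μ₁ * u x) * max (g x - δ) 0 ^ k) x ≤ C₀ := by
  have lapc : Continuous (lap g) := continuous_iff_continuousAt.2 fun x =>
    continuousAt_lap hg.contDiffAt
  obtain ⟨CL, hCL⟩ := hb.isCompact_closure.exists_bound_of_continuousOn lapc.continuousOn
  obtain ⟨G, hG⟩ := hb.isCompact_closure.exists_bound_of_continuousOn hg.continuous.continuousOn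
  set CL' := max CL 0
  set G' := max G 1
  have hCL' : ∀ x ∈ E, |lap g x| ≤ CL' :=
    fun x hx => (hCL x (subset_closure hx)).trans (le_max_left _ _)
  have hG' : ∀ x ∈ E, g x ≤ G' := fun x hx =>
    (le_abs_self _).trans ((hG x (subset_closure hx)).trans (le_max_left _ _))
  have hCL0 : 0 ≤ CL' := le_max_right _ _
  have hG0 : 0 < G' := zero_lt_one.trans_le (le_max_right _ _)
  obtain ⟨n, hn⟩ := exists_nat_ge ((CL' + (μ₁ * H + 1) * G') / c)
  rw [div_le_iff₀ hc] at hn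
  set Cb' := max Cb 0
  have hCb0 : 0 ≤ Cb' := le_max_right _ _
  set α := (g₀ / 2) ^ (n + 3) * b₀ with hα
  set β := (n + 3) * G' ^ (n + 2) * CL' + (μ₁ * H + 1) * G' ^ (n + 3) with hβ
  have hα0 : 0 < α := by positivity
  have hβ0 : 0 ≤ β := by positivity
  set C₁ := (α + β * Real.exp (β / α)) + Cb' * G' ^ (n + 3) with hC₁
  have hC₁0 : 0 ≤ C₁ := by positivity
  refine ⟨n + 3, C₁ * volume.real E, fun δ hδ hδg u hu hu2 => ?_⟩
  obtain ⟨hϕ, hϕc, hϕs⟩ := contDiff_indicator_max_sub_pow hE hb hg hfr hδ n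
  set ϕ := E.indicator fun x => max (g x - δ) 0 ^ (n + 3) with hϕdef
  set z : EuclideanSpace ℝ (Fin N) → ℝ := fun x => Real.exp (μ₁ * u x) with hz
  have hzc : ContDiffOn ℝ 2 z E := (contDiffOn_const.mul hu).exp
  obtain ⟨I1, I2, hgreen⟩ := integral_mul_lap_comm hE hϕ hϕc hϕs hzc
  have I3 : Integrable fun x => ϕ x * z x :=
    integrable_mul_of_tsupport_subset hE hϕ.continuous hϕc hϕs hzc.continuousOn
  have hEq : (E.indicator fun x => Real.exp (μ₁ * u x) * max (g x - δ) 0 ^ (n + 3)) =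
      fun x => ϕ x * z x := by
    funext x
    by_cases hx : x ∈ E <;> simp [hϕdef, hx, hz, mul_comm]
  have hfin : volume E ≠ ⊤ := hb.measure_lt_top.ne
  have I4 : Integrable (E.indicator fun _ => C₁) :=
    (integrable_indicator_iff hE.measurableSet).2 (integrableOn_const hfin)
  have hpt : ∀ x, ϕ x * z x ≤ (lap ϕ x * z x - ϕ x * lap z x) + E.indicator (fun _ => C₁) x := by
    intro x
    by_cases hx : x ∈ E
    · obtain ⟨b, h, hb0, hbC, hhH, hbS, hineq⟩ := hu2 x hx
      set w := max (g x - δ) 0 with hw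
      set Z := Real.exp (μ₁ * u x) with hZ
      have hZ0 : 0 < Z := Real.exp_pos _
      have hw0 : 0 ≤ w := le_max_right _ _
      have hwg : w ≤ g x := max_le (by linarith) (hpos x hx)
      have hwG : w ≤ G' := hwg.trans (hG' x hx)
      have hϕx : ϕ x = w ^ (n + 3) := by simp [hϕdef, hx, hw]
      have hzx : z x = Z := rfl
      have hlapϕ : lap ϕ x = (n + 3) * w ^ (n + 2) * lap g x +
          (n + 3) * (n + 2) * w ^ (n + 1) * ‖gradient g x‖ ^ 2 := by
        have h1 : ϕ =ᶠ[𝓝 x] fun y => (fun t => max (t - δ) 0 ^ (n + 3)) (g y) := by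
          filter_upwards [hE.mem_nhds hx] with y hy
          simp [hϕdef, hy]
        rw [lap_congr h1, lap_comp (f := fun t => max (t - δ) 0 ^ (n + 3))
          (f' := fun t => (n + 3) * max (t - δ) 0 ^ (n + 2))
          (f'' := fun t => (n + 3) * (n + 2) * max (t - δ) 0 ^ (n + 1)) _ _ hg.contDiffAt]
        · intro t
          have := (hasDerivAt_max_zero_pow (n + 1) (t - δ)).comp_sub_const t δ
          refine this.congr_deriv ?_
          push_cast
          ring
        · intro t
          have := ((hasDerivAt_max_zero_pow n (t - δ)).comp_sub_const t δ).const_mul ((n : ℝ) + 3)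
          refine this.congr_deriv ?_
          ring
      have hlapz : lap z x = μ₁ * Z * (lap u x + μ₁ * ‖gradient u x‖ ^ 2) := by
        have hd : ∀ t, HasDerivAt (fun t => Real.exp (μ₁ * t)) (μ₁ * Real.exp (μ₁ * t)) t := by
          intro t
          have := ((hasDerivAt_id t).const_mul μ₁).exp
          refine this.congr_deriv ?_
          simp [mul_comm]
        have := lap_comp hd (fun t => (hd t).const_mul μ₁) (hu.contDiffAt (hE.mem_nhds hx))
        rw [hz, this, ← hZ]
        ring
      rw [hϕx, hzx, hlapz, indicator_of_mem hx]
      set W := w ^ (n + 3) with hW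
      have hW0 : 0 ≤ W := by positivity
      have hWG : W ≤ G' ^ (n + 3) := pow_le_pow_left₀ hw0 hwG _
      have hZt := neg_one_le_exp_mul_self (μ₁ * u x)
      rw [← hZ] at hZt
      have hbC' : b ≤ Cb' := hbC.trans (le_max_left _ _)
      have hWb : W * b ≤ Cb' * G' ^ (n + 3) := by
        rw [mul_comm]
        exact mul_le_mul hbC' hWG hW0 hCb0
      have hstep : W * b * (Z * (μ₁ * u x)) - W * Z * (μ₁ * H) ≤
          -(W * (μ₁ * Z * (lap u x + μ₁ * ‖gradient u x‖ ^ 2))) := by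
        have h1 := mul_le_mul_of_nonneg_left hineq (by positivity : 0 ≤ W * (μ₁ * Z))
        have h2 := mul_le_mul_of_nonneg_left (neg_abs_le h) (by positivity : 0 ≤ W * (μ₁ * Z))
        have h3 := mul_le_mul_of_nonneg_left hhH (by positivity : 0 ≤ W * (μ₁ * Z))
        linarith
      suffices hfin : -C₁ ≤ Z * (lap ϕ x - (μ₁ * H + 1) * W) + W * b * (Z * (μ₁ * u x)) by
        linarith
      have hlg := abs_le.1 (hCL' x hx)
      by_cases hxS : x ∈ S
      · have hL : -((n + 3) * G' ^ (n + 2) * CL') ≤ lap ϕ x := by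
          have h1 : (n + 3) * w ^ (n + 2) * CL' ≤ (n + 3) * G' ^ (n + 2) * CL' := by gcongr
          have h2 := mul_le_mul_of_nonneg_left hlg.1 (by positivity : 0 ≤ (n + 3) * w ^ (n + 2))
          have h3 : 0 ≤ (n + 3) * (n + 2) * w ^ (n + 1) * ‖gradient g x‖ ^ 2 := by positivity
          linarith
        have hβ' : -β ≤ lap ϕ x - (μ₁ * H + 1) * W := by
          have := mul_le_mul_of_nonneg_left hWG (by positivity : 0 ≤ μ₁ * H + 1)
          linarith
        have hαW : α ≤ W * b := by
          have h1 : g₀ / 2 ≤ w := le_max_of_le_left (by linarith [hS x hxS])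
          have h2 := hbS hxS
          rw [hα, hW]
          gcongr
        have h1 := neg_le_exp_mul_linear hα0 hβ0 (μ₁ * u x)
        rw [← hZ] at h1
        have h2 := mul_le_mul_of_nonneg_left hβ' hZ0.le
        have h3 := mul_le_mul_of_nonneg_left hZt (sub_nonneg.2 hαW)
        clear_value C₁ α β W Z
        linarith
      · have hL : (μ₁ * H + 1) * W ≤ lap ϕ x := by
          have hD := hgrad x hx hxS
          have h2 : c * w ≤ ‖gradient g x‖ ^ 2 := by nlinarith
          rw [hlapϕ]
          exact mul_pow_le_of_gradient_bound hc (by positivity) hw0 hwG hlg.1 h2 hn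
        have h1 : 0 ≤ Z * (lap ϕ x - (μ₁ * H + 1) * W) := mul_nonneg hZ0.le (by linarith)
        have h2 := mul_le_mul_of_nonneg_left hZt (by positivity : 0 ≤ W * b)
        have h3 : 0 ≤ α + β * Real.exp (β / α) := by positivity
        linarith
    · have h0 : lap ϕ x = 0 := by
        have h1 : ϕ =ᶠ[𝓝 x] fun _ => 0 := notMem_tsupport_iff_eventuallyEq.1 fun h => hx (hϕs h)
        rw [lap_congr h1, lap_zero]
      have h2 : ϕ x = 0 := by simp [hϕdef, hx]
      simp [h0, h2, hx]
  rw [hEq]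
  refine ⟨I3, ?_⟩
  calc ∫ x, ϕ x * z x ≤ ∫ x, ((lap ϕ x * z x - ϕ x * lap z x) + E.indicator (fun _ => C₁) x) :=
        integral_mono I3 ((I2.sub I1).add I4) hpt
    _ = C₁ * volume.real E := by
        rw [integral_add (f := fun x => lap ϕ x * z x - ϕ x * lap z x) (I2.sub I1) I4,
          integral_sub I2 I1, hgreen, sub_self, zero_add,
          integral_indicator hE.measurableSet]
        simp [mul_comm]

end WeightedBound

section Barrier

variable {N : ℕ}

theorem hasGradientAt_barrier (x₀ y : EuclideanSpace ℝ (Fin N)) (r B C : ℝ)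
    (x : EuclideanSpace ℝ (Fin N)) :
    HasGradientAt (fun x => (r ^ 2 - ‖x - x₀‖ ^ 2) * (Real.exp (-B * ‖x - y‖ ^ 2) - C))
      ((-2 : ℝ) • ((Real.exp (-B * ‖x - y‖ ^ 2) - C) • (x - x₀) +
        ((r ^ 2 - ‖x - x₀‖ ^ 2) * (B * Real.exp (-B * ‖x - y‖ ^ 2))) • (x - y))) x := by
  have h : ∀ z : EuclideanSpace ℝ (Fin N), HasFDerivAt (fun x => ‖x - z‖ ^ 2)
      (2 • innerSL ℝ (x - z)) x := fun z => by
    have := (hasStrictFDerivAt_norm_sq (x - z)).hasFDerivAt.comp x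
      ((hasFDerivAt_id x).sub_const z)
    refine this.congr_fderiv ?_
    ext v
    simp
  rw [hasGradientAt_iff_hasFDerivAt]
  have := ((h x₀).const_sub (r ^ 2)).mul ((((h y).const_mul (-B)).exp).sub_const C)
  refine this.congr_fderiv ?_
  ext v
  simp
  ring

theorem norm_sq_barrier_ge {a b : EuclideanSpace ℝ (Fin N)} {r m s' ρ' B e e₀ P s : ℝ}
    (hm : 0 < m) (hms : m ^ 2 = r ^ 2 - s') (hab : ‖a - b‖ = m) (hr : 0 < r)
    (hs' : 0 < s') (hρ' : 0 < ρ') (hB : B = (r + 1) / (s' * ρ')) (he₀ : 0 < e₀) (hee : e₀ ≤ e)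
    (hP : 0 ≤ P) (hPe : P ≤ e) (he1 : e ≤ 1) (hs : 0 < s) (ha : ‖a‖ ^ 2 = r ^ 2 - s)
    (hb : ρ' ≤ ‖b‖) :
    min (2 * m * (B * e₀) * ρ') (e₀ ^ 2 / r ^ 2) * (s * P) ≤
      ‖P • a + (s * (B * e)) • b‖ ^ 2 := by
  have hB0 : 0 < B := by rw [hB]; positivity
  have he0 : 0 < e := he₀.trans_le hee
  have hsP : 0 ≤ s * P := by positivity
  rcases le_total s s' with h | h
  · refine (mul_le_mul_of_nonneg_right (min_le_left _ _) hsP).trans ?_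
    have h1 : 0 ≤ inner ℝ a b := by
      have := norm_sub_sq_real a b
      rw [hab, ha, hms] at this
      nlinarith [sq_nonneg ‖b‖]
    rw [norm_add_sq_real, norm_smul, norm_smul, inner_smul_left, inner_smul_right,
      Real.norm_of_nonneg hP, Real.norm_of_nonneg (by positivity : 0 ≤ s * (B * e))]
    have h2 : m ≤ ‖a‖ := by
      rw [← abs_of_pos hm, ← abs_of_nonneg (norm_nonneg a), ← sq_le_sq]
      linarith
    have h3 : P * m ≤ P * ‖a‖ := by gcongr
    have h4 : s * (B * e₀) * ρ' ≤ s * (B * e) * ‖b‖ := by gcongr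
    have h5 : (P * m) ^ 2 ≤ (P * ‖a‖) ^ 2 := by gcongr
    have h6 : (s * (B * e₀) * ρ') ^ 2 ≤ (s * (B * e) * ‖b‖) ^ 2 := by gcongr
    have h7 : 0 ≤ 2 * (P * (s * (B * e) * inner ℝ a b)) := by positivity
    have h8 := two_mul_le_add_sq (P * m) (s * (B * e₀) * ρ')
    simp only [conj_trivial]
    linarith
  · refine (mul_le_mul_of_nonneg_right (min_le_right _ _) hsP).trans ?_
    have har : ‖a‖ ≤ r := by
      rw [← abs_of_pos hr, ← abs_of_nonneg (norm_nonneg a), ← sq_le_sq]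
      linarith
    have hsr : s ≤ r ^ 2 := by nlinarith [sq_nonneg ‖a‖]
    have h1 : e₀ ≤ ‖P • a + (s * (B * e)) • b‖ := by
      have h2 := norm_sub_le_norm_add ((s * (B * e)) • b) (P • a)
      rw [norm_smul, norm_smul, Real.norm_of_nonneg hP,
        Real.norm_of_nonneg (by positivity : 0 ≤ s * (B * e)), add_comm] at h2
      have h3 : P * ‖a‖ ≤ e * r := by gcongr
      have h4 : s' * (B * e) * ρ' ≤ s * (B * e) * ‖b‖ := by gcongr
      have h5 : s' * (B * e) * ρ' = (r + 1) * e := by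
        rw [hB]
        field_simp
      linarith
    calc e₀ ^ 2 / r ^ 2 * (s * P) ≤ e₀ ^ 2 / r ^ 2 * (r ^ 2 * 1) := by
          gcongr
          linarith
      _ = e₀ ^ 2 := by field_simp
      _ ≤ _ := by gcongr

theorem exists_barrier {x₀ y : EuclideanSpace ℝ (Fin N)} {r ρ' ρ R : ℝ} (hr : 0 < r)
    (hρ' : 0 < ρ') (hρ : ρ' < ρ) (hR : 0 < R) (hRρ : R < ρ) (hy : y ≠ x₀)
    (hsub : closedBall y ρ' ⊆ ball x₀ r) :
    ∃ (g : EuclideanSpace ℝ (Fin N) → ℝ) (c g₀ p : ℝ), ContDiff ℝ 2 g ∧ 0 < c ∧ 0 < g₀ ∧ 0 < p ∧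
      (∀ x ∈ frontier (ball x₀ r ∩ ball y ρ), g x ≤ 0) ∧
      (∀ x ∈ ball x₀ r ∩ ball y ρ, 0 ≤ g x) ∧
      (∀ x ∈ ball x₀ r ∩ ball y ρ, x ∉ closedBall y ρ' → c * g x ≤ ‖gradient g x‖ ^ 2) ∧
      (∀ x ∈ closedBall y ρ', g₀ ≤ g x) ∧
      ∀ x ∈ ball x₀ r ∩ ball y R, p * (r ^ 2 - ‖x - x₀‖ ^ 2) ≤ g x := by
  set m := ‖y - x₀‖ with hmdef
  have hm : 0 < m := norm_pos_iff.2 (sub_ne_zero.2 hy)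
  have hyr : m < r := by simpa [dist_eq_norm] using hsub (mem_closedBall_self hρ'.le)
  set s' := r ^ 2 - m ^ 2 with hs'def
  have hs' : 0 < s' := by nlinarith
  set B := (r + 1) / (s' * ρ') with hB
  have hB0 : 0 < B := by positivity
  set e₀ := Real.exp (-B * ρ ^ 2) with he₀
  set g : EuclideanSpace ℝ (Fin N) → ℝ := fun x =>
    (r ^ 2 - ‖x - x₀‖ ^ 2) * (Real.exp (-B * ‖x - y‖ ^ 2) - e₀) with hg
  have hgc : ContDiff ℝ 2 g := by
    refine (contDiff_const.sub ((contDiff_id.sub contDiff_const).norm_sq ℝ)).mul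
      (((contDiff_const.mul ((contDiff_id.sub contDiff_const).norm_sq ℝ)).exp).sub contDiff_const)
  have hspos : ∀ x ∈ ball x₀ r, 0 < r ^ 2 - ‖x - x₀‖ ^ 2 := by
    intro x hx
    rw [mem_ball, dist_eq_norm] at hx
    nlinarith [norm_nonneg (x - x₀)]
  have hexp : ∀ x t, ‖x - y‖ ≤ t → Real.exp (-B * t ^ 2) ≤ Real.exp (-B * ‖x - y‖ ^ 2) := by
    intro x t ht
    have : ‖x - y‖ ^ 2 ≤ t ^ 2 := by gcongr
    rw [Real.exp_le_exp]
    nlinarith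
  have hlt : ∀ t, 0 ≤ t → t < ρ → e₀ < Real.exp (-B * t ^ 2) := by
    intro t ht0 ht
    have : t ^ 2 < ρ ^ 2 := by gcongr
    rw [he₀, Real.exp_lt_exp]
    nlinarith
  have hgpos : ∀ x ∈ closedBall y ρ', 0 < g x := by
    intro x hx
    have h1 : ‖x - y‖ ≤ ρ' := by simpa [dist_eq_norm] using hx
    exact mul_pos (hspos x (hsub hx)) (sub_pos.2 (hlt _ (norm_nonneg _) (h1.trans_lt hρ)))
  obtain ⟨z, hz, hzmin⟩ := (isCompact_closedBall y ρ').exists_isMinOn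
    ⟨y, mem_closedBall_self hρ'.le⟩ hgc.continuous.continuousOn
  have hc : 0 < min (2 * m * (B * e₀) * ρ') (e₀ ^ 2 / r ^ 2) := by
    have : 0 < e₀ := Real.exp_pos _
    exact lt_min (by positivity) (by positivity)
  refine ⟨g, 4 * min (2 * m * (B * e₀) * ρ') (e₀ ^ 2 / r ^ 2), g z,
    Real.exp (-B * R ^ 2) - e₀, hgc, by linarith, hgpos z hz, sub_pos.2 (hlt R hR.le hRρ),
    ?_, ?_, ?_, fun x hx => hzmin hx, ?_⟩
  · intro x hx
    have hE : IsOpen (ball x₀ r ∩ ball y ρ) := isOpen_ball.inter isOpen_ball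
    rw [hE.frontier_eq] at hx
    obtain ⟨h1, h2⟩ := hx
    have h3 : ‖x - x₀‖ ≤ r := by
      have := closure_ball_subset_closedBall (closure_mono inter_subset_left h1)
      simpa [dist_eq_norm] using this
    have h4 : ‖x - y‖ ≤ ρ := by
      have := closure_ball_subset_closedBall (closure_mono inter_subset_right h1)
      simpa [dist_eq_norm] using this
    simp only [mem_inter_iff, mem_ball, dist_eq_norm, not_and_or, not_lt] at h2
    rcases h2 with h2 | h2
    · simp [hg, le_antisymm h3 h2]
    · simp [hg, he₀, le_antisymm h4 h2]
  · intro x hx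
    have h4 : ‖x - y‖ < ρ := by simpa [dist_eq_norm] using hx.2
    exact mul_nonneg (hspos x hx.1).le (sub_nonneg.2 (hexp x ρ h4.le))
  · intro x hx hxS
    have h4 : ‖x - y‖ < ρ := by simpa [dist_eq_norm] using hx.2
    have h5 : ρ' ≤ ‖x - y‖ := by
      have : ρ' < ‖x - y‖ := by simpa [dist_eq_norm] using hxS
      exact this.le
    rw [(hasGradientAt_barrier x₀ y r B e₀ x).gradient, norm_smul, mul_pow]
    have := norm_sq_barrier_ge (a := x - x₀) (b := x - y) (e₀ := e₀)
      (e := Real.exp (-B * ‖x - y‖ ^ 2)) (P := Real.exp (-B * ‖x - y‖ ^ 2) - e₀)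
      (s := r ^ 2 - ‖x - x₀‖ ^ 2) hm (by rw [hs'def]; ring) (by rw [hmdef]; congr 1; abel) hr hs'
      hρ' hB (Real.exp_pos _) (hexp x ρ h4.le) (sub_nonneg.2 (hexp x ρ h4.le))
      (by linarith [Real.exp_pos (-B * ρ ^ 2)])
      (Real.exp_le_one_iff.2 (by nlinarith [sq_nonneg ‖x - y‖])) (hspos x hx.1) (by ring) h5
    norm_num
    simp only [hg, neg_mul] at this ⊢
    linarith
  · intro x hx
    have h4 : ‖x - y‖ < R := by simpa [dist_eq_norm] using hx.2
    have h5 := hexp x R h4.le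
    rw [mul_comm]
    exact mul_le_mul_of_nonneg_left (by linarith) (hspos x hx.1).le

/-- The exponential of a supersolution is integrable up to the boundary of the ball, with a
power weight in the distance to the boundary. -/
theorem exists_setIntegral_exp_le {x₀ y : EuclideanSpace ℝ (Fin N)} {r ρ' ρ R : ℝ} (hr : 0 < r)
    (hρ' : 0 < ρ') (hρ : ρ' < ρ) (hR : 0 < R) (hRρ : R < ρ) (hy : y ≠ x₀)
    (hsub : closedBall y ρ' ⊆ ball x₀ r) {μ₁ b₀ H : ℝ} (Cb : ℝ) (hμ₁ : 0 < μ₁) (hb₀ : 0 < b₀)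
    (hH : 0 ≤ H) :
    ∃ (k : ℕ) (C₀ τ₀ : ℝ), 0 < τ₀ ∧ 0 ≤ C₀ ∧ ∀ u : EuclideanSpace ℝ (Fin N) → ℝ,
      ContDiffOn ℝ 2 u (ball x₀ r) →
      (∀ x ∈ ball x₀ r ∩ ball y ρ, ∃ b h : ℝ, 0 ≤ b ∧ b ≤ Cb ∧ |h| ≤ H ∧
        (x ∈ closedBall y ρ' → b₀ ≤ b) ∧
        lap u x + μ₁ * ‖gradient u x‖ ^ 2 ≤ -(b * u x + h)) →
      ∀ τ, 0 < τ → τ ≤ τ₀ →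
        IntegrableOn (fun x => Real.exp (μ₁ * u x))
          (ball y R ∩ {x | τ ≤ r ^ 2 - ‖x - x₀‖ ^ 2}) ∧
        ∫ x in ball y R ∩ {x | τ ≤ r ^ 2 - ‖x - x₀‖ ^ 2}, Real.exp (μ₁ * u x) ≤ C₀ / τ ^ k := by
  obtain ⟨g, c, g₀, p, hg, hc, hg₀, hp, hfr, hpos, hgrad, hS, hpg⟩ :=
    exists_barrier hr hρ' hρ hR hRρ hy hsub
  have hE : IsOpen (ball x₀ r ∩ ball y ρ) := isOpen_ball.inter isOpen_ball
  obtain ⟨k, C₀, hk⟩ := exists_integral_exp_mul_le hE (isBounded_ball.subset inter_subset_left)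
    hg hfr hpos hc hg₀ hgrad hS (Cb := Cb) hμ₁ hb₀ hH
  refine ⟨k, max C₀ 0 / (p / 2) ^ k, g₀ / p, by positivity, by positivity,
    fun u hu hu2 τ hτ hττ => ?_⟩
  rw [le_div_iff₀ hp] at hττ
  obtain ⟨hI, hC⟩ := hk (p / 2 * τ) (by positivity) (by linarith) u (hu.mono inter_subset_left) hu2
  set T := ball y R ∩ {x | τ ≤ r ^ 2 - ‖x - x₀‖ ^ 2} with hT
  have hTm : MeasurableSet T :=
    measurableSet_ball.inter (measurableSet_le measurable_const (by fun_prop))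
  have hTE : ∀ x ∈ T, x ∈ ball x₀ r := by
    intro x hx
    have : τ ≤ r ^ 2 - ‖x - x₀‖ ^ 2 := hx.2
    rw [mem_ball, dist_eq_norm]
    exact lt_of_pow_lt_pow_left₀ 2 hr.le (by linarith)
  have hTu : ContinuousOn (fun x => Real.exp (μ₁ * u x)) T :=
    ((continuousOn_const.mul (hu.continuousOn.mono hTE)).rexp)
  set F := (ball x₀ r ∩ ball y ρ).indicator
    fun x => Real.exp (μ₁ * u x) * max (g x - p / 2 * τ) 0 ^ k with hF
  have hF0 : ∀ x, 0 ≤ F x := fun x => indicator_nonneg (fun x _ => by positivity) _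
  have hpτ : 0 < (p / 2 * τ) ^ k := by positivity
  have hle : ∀ x ∈ T, Real.exp (μ₁ * u x) ≤ F x / (p / 2 * τ) ^ k := by
    intro x hx
    have hxE : x ∈ ball x₀ r ∩ ball y ρ := ⟨hTE x hx, ball_subset_ball hRρ.le hx.1⟩
    rw [hF, indicator_of_mem hxE, le_div_iff₀ hpτ]
    have h1 := hpg x ⟨hTE x hx, hx.1⟩
    have h2 : τ ≤ r ^ 2 - ‖x - x₀‖ ^ 2 := hx.2
    have h3 : p / 2 * τ ≤ max (g x - p / 2 * τ) 0 := le_max_of_le_left (by nlinarith)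
    gcongr
  have hint : IntegrableOn (fun x => Real.exp (μ₁ * u x)) T := by
    refine ((hI.div_const ((p / 2 * τ) ^ k)).integrableOn).mono'
      (hTu.aestronglyMeasurable hTm) ?_
    refine (ae_restrict_iff' hTm).2 (Filter.Eventually.of_forall fun x hx => ?_)
    rw [Real.norm_of_nonneg (Real.exp_pos _).le]
    exact hle x hx
  refine ⟨hint, ?_⟩
  calc ∫ x in T, Real.exp (μ₁ * u x) ≤ ∫ x in T, F x / (p / 2 * τ) ^ k :=
        setIntegral_mono_on hint (hI.div_const _).integrableOn hTm hle
    _ ≤ ∫ x, F x / (p / 2 * τ) ^ k :=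
        setIntegral_le_integral (hI.div_const _)
          (Filter.Eventually.of_forall fun x => div_nonneg (hF0 x) hpτ.le)
    _ = (∫ x, F x) / (p / 2 * τ) ^ k := integral_div _ _
    _ ≤ max C₀ 0 / (p / 2 * τ) ^ k := by
        gcongr
        exact hC.trans (le_max_left _ _)
    _ = max C₀ 0 / (p / 2) ^ k / τ ^ k := by rw [mul_pow, div_div]

end Barrier

section Truncation

variable {N : ℕ}

theorem hasDerivAt_exp_linear (K c t : ℝ) :
    HasDerivAt (fun t => Real.exp (K * (t - 1)) - c) (K * Real.exp (K * (t - 1))) t := by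
  have := ((((hasDerivAt_id t).sub_const 1).const_mul K).exp).sub_const c
  refine this.congr_deriv ?_
  simp [mul_comm]

/-- The truncated exponential of `u`, extended by zero outside `Ω`. -/
noncomputable def truncExp (Ω : Set (EuclideanSpace ℝ (Fin N))) (K : ℝ)
    (u : EuclideanSpace ℝ (Fin N) → ℝ) : EuclideanSpace ℝ (Fin N) → ℝ :=
  Ω.indicator fun x => max (Real.exp (K * (u x - 1)) - 1) 0 ^ 3

theorem truncExp_nonneg (Ω : Set (EuclideanSpace ℝ (Fin N))) (K : ℝ)
    (u : EuclideanSpace ℝ (Fin N) → ℝ) (x : EuclideanSpace ℝ (Fin N)) : 0 ≤ truncExp Ω K u x :=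
  indicator_nonneg (fun _ _ => by positivity) x

theorem truncExp_le {Ω : Set (EuclideanSpace ℝ (Fin N))} (K : ℝ)
    (u : EuclideanSpace ℝ (Fin N) → ℝ) {x : EuclideanSpace ℝ (Fin N)} (hx : x ∈ Ω) :
    truncExp Ω K u x ≤ Real.exp (3 * K * (u x - 1)) := by
  rw [truncExp, indicator_of_mem hx,
    show 3 * K * (u x - 1) = (3 : ℕ) * (K * (u x - 1)) by push_cast; ring, Real.exp_nat_mul]
  gcongr
  exact max_le (by linarith) (Real.exp_pos _).le

theorem contDiff_truncExp {Ω : Set (EuclideanSpace ℝ (Fin N))} (hΩ : IsOpen Ω)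
    (hb : Bornology.IsBounded Ω) {K : ℝ} (hK : 0 < K) {u : EuclideanSpace ℝ (Fin N) → ℝ}
    (hu : ContDiffOn ℝ 2 u Ω) (huc : ContinuousOn u (closure Ω))
    (hu0 : ∀ x ∈ frontier Ω, u x = 0) :
    ContDiff ℝ 2 (truncExp Ω K u) ∧ HasCompactSupport (truncExp Ω K u) ∧
      ∀ x ∉ Ω, truncExp Ω K u =ᶠ[𝓝 x] fun _ => 0 := by
  set T := closure Ω ∩ u ⁻¹' Ici 1 with hT
  have hTc : IsClosed T := huc.preimage_isClosed_of_isClosed isClosed_closure isClosed_Ici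
  have hTK : IsCompact T := hb.isCompact_closure.of_isClosed_subset hTc inter_subset_left
  have hTΩ : T ⊆ Ω := by
    intro x hx
    by_contra h
    have h1 := hu0 x (by rw [hΩ.frontier_eq]; exact ⟨hx.1, h⟩)
    have h2 : 1 ≤ u x := hx.2
    linarith
  have hzero : ∀ x ∉ T, truncExp Ω K u x = 0 := by
    intro x hx
    by_cases hxΩ : x ∈ Ω
    · have h1 : u x < 1 := by
        by_contra h
        exact hx ⟨subset_closure hxΩ, not_lt.1 h⟩
      rw [truncExp, indicator_of_mem hxΩ, max_eq_right]
      · simp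
      · rw [sub_nonpos, Real.exp_le_one_iff]
        nlinarith
    · exact indicator_of_notMem hxΩ _
  have hloc : ∀ x ∉ Ω, truncExp Ω K u =ᶠ[𝓝 x] fun _ => 0 := by
    intro x hx
    filter_upwards [hTc.isOpen_compl.mem_nhds fun h => hx (hTΩ h)] with y hy
    exact hzero y hy
  refine ⟨contDiff_iff_contDiffAt.2 fun x => ?_, HasCompactSupport.intro hTK hzero, hloc⟩
  by_cases hx : x ∈ Ω
  · have h1 : ContDiffAt ℝ 2 (fun x => max (Real.exp (K * (u x - 1)) - 1) 0 ^ 3) x :=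
      (contDiff_max_zero_pow 0).contDiffAt.comp x
        (((contDiffAt_const.mul ((hu.contDiffAt (hΩ.mem_nhds hx)).sub contDiffAt_const)).exp).sub
          contDiffAt_const)
    refine h1.congr_of_eventuallyEq ?_
    filter_upwards [hΩ.mem_nhds hx] with y hy
    exact indicator_of_mem hy _
  · exact contDiffAt_const.congr_of_eventuallyEq (hloc x hx)

theorem neg_le_lap_truncExp {Ω : Set (EuclideanSpace ℝ (Fin N))} (hΩ : IsOpen Ω)
    (hb : Bornology.IsBounded Ω) {K L A : ℝ} (hK : 0 < K) (hL : 0 ≤ L) (hA : 1 ≤ A)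
    {u : EuclideanSpace ℝ (Fin N) → ℝ} (hu : ContDiffOn ℝ 2 u Ω) (huc : ContinuousOn u (closure Ω))
    (hu0 : ∀ x ∈ frontier Ω, u x = 0) {x : EuclideanSpace ℝ (Fin N)}
    (hx : x ∈ Ω → u x ≤ A ∧
      (1 < u x → -lap u x ≤ L * (u x + 1) + K * ‖gradient u x‖ ^ 2)) :
    -(3 * K * L * Real.exp (3 * K * (A - 1)) * (A + 1)) ≤ lap (truncExp Ω K u) x := by
  have hneg : -(3 * K * L * Real.exp (3 * K * (A - 1)) * (A + 1)) ≤ 0 := by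
    have : 0 ≤ A + 1 := by linarith
    rw [neg_nonpos]
    positivity
  by_cases hxΩ : x ∈ Ω
  · obtain ⟨hxA, hxu⟩ := hx hxΩ
    set w : ℝ → ℝ := fun t => max (Real.exp (K * (t - 1)) - 1) 0 with hw
    have hev : truncExp Ω K u =ᶠ[𝓝 x] fun y => (fun t => w t ^ 3) (u y) := by
      filter_upwards [hΩ.mem_nhds hxΩ] with y hy
      exact indicator_of_mem hy _
    have d1 : ∀ t, HasDerivAt (fun t => w t ^ 3)
        (3 * w t ^ 2 * (K * Real.exp (K * (t - 1)))) t := by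
      intro t
      have := (hasDerivAt_max_zero_pow 1 (Real.exp (K * (t - 1)) - 1)).comp t
        (hasDerivAt_exp_linear K 1 t)
      refine this.congr_deriv ?_
      push_cast
      ring
    have d2 : ∀ t, HasDerivAt (fun t => 3 * w t ^ 2 * (K * Real.exp (K * (t - 1))))
        (6 * w t * (K * Real.exp (K * (t - 1))) ^ 2 +
          K * (3 * w t ^ 2 * (K * Real.exp (K * (t - 1))))) t := by
      intro t
      have h1 := (hasDerivAt_max_zero_pow 0 (Real.exp (K * (t - 1)) - 1)).comp t
        (hasDerivAt_exp_linear K 1 t)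
      have h2 := (hasDerivAt_exp_linear K 0 t).const_mul K
      simp only [sub_zero] at h2
      refine ((h1.const_mul 3).mul h2).congr_deriv ?_
      simp [hw]
      ring
    rw [lap_congr hev, lap_comp d1 d2 (hu.contDiffAt (hΩ.mem_nhds hxΩ))]
    have hw0 : 0 ≤ w (u x) := le_max_right _ _
    rcases le_or_gt (u x) 1 with h1 | h1
    · have : w (u x) = 0 := by
        simp only [hw]
        rw [max_eq_right]
        rw [sub_nonpos, Real.exp_le_one_iff]
        nlinarith
      simpa [this] using hneg
    · set X := Real.exp (K * (u x - 1)) with hX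
      have hX0 : 0 < X := Real.exp_pos _
      have hwX : w (u x) ≤ X := max_le (by linarith) hX0.le
      have h2 := hxu h1
      set P := 3 * w (u x) ^ 2 * (K * X) with hP
      have hP0 : 0 ≤ P := by positivity
      have hPX : P ≤ 3 * K * Real.exp (3 * K * (A - 1)) := by
        have h3 : P ≤ 3 * X ^ 2 * (K * X) := by rw [hP]; gcongr
        have h4 : 3 * X ^ 2 * (K * X) = 3 * K * Real.exp (3 * K * (u x - 1)) := by
          rw [show 3 * K * (u x - 1) = (3 : ℕ) * (K * (u x - 1)) by push_cast; ring,
            Real.exp_nat_mul, ← hX]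
          ring
        have h5 : 3 * K * Real.exp (3 * K * (u x - 1)) ≤ 3 * K * Real.exp (3 * K * (A - 1)) := by
          gcongr
        linarith
      have h6 : P * (L * (u x + 1)) ≤ 3 * K * Real.exp (3 * K * (A - 1)) * (L * (A + 1)) := by
        have : 0 ≤ u x + 1 := by linarith
        gcongr
      have h7 := mul_le_mul_of_nonneg_left h2 hP0
      have h8 : 0 ≤ 6 * w (u x) * (K * X) ^ 2 * ‖gradient u x‖ ^ 2 := by positivity
      linarith
  · rw [lap_congr ((contDiff_truncExp hΩ hb hK hu huc hu0).2.2 x hxΩ), lap_zero]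
    exact hneg

/-- The volume of a thin shell in a ball is linear in its thickness. -/
theorem exists_volume_shell_le (x₀ : EuclideanSpace ℝ (Fin N)) {r : ℝ} (hr : 0 < r) :
    ∃ C : ℝ, 0 ≤ C ∧ ∀ τ, 0 ≤ τ →
      volume.real (ball x₀ r ∩ {x | r ^ 2 - ‖x - x₀‖ ^ 2 < τ}) ≤ C * τ := by
  set ω := volume.real (ball (0 : EuclideanSpace ℝ (Fin N)) 1) with hω
  have hvol : ∀ t : ℝ, 0 < t → volume.real (ball x₀ t) = t ^ N * ω := by
    intro t ht
    rw [Measure.real, Measure.addHaar_ball_of_pos volume x₀ ht]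
    simp [hω, Measure.real, ht.le]
  have hω0 : 0 ≤ r ^ N * ω := by positivity
  refine ⟨r ^ N * ω * (N + 1) / r ^ 2, by positivity, fun τ hτ => ?_⟩
  rcases le_or_gt (r ^ 2) τ with h | h
  · calc volume.real (ball x₀ r ∩ {x | r ^ 2 - ‖x - x₀‖ ^ 2 < τ}) ≤ volume.real (ball x₀ r) :=
          measureReal_mono inter_subset_left measure_ball_lt_top.ne
      _ = r ^ N * ω * 1 / r ^ 2 * r ^ 2 := by rw [hvol r hr]; field_simp
      _ ≤ r ^ N * ω * (N + 1) / r ^ 2 * τ := by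
          gcongr
          linarith [(Nat.cast_nonneg N : (0 : ℝ) ≤ N)]
  · set t := √(r ^ 2 - τ) with ht
    have ht0 : 0 < t := Real.sqrt_pos.2 (by linarith)
    have htτ : t ^ 2 = r ^ 2 - τ := Real.sq_sqrt (by linarith)
    have htr : t ≤ r := (sq_le_sq₀ ht0.le hr.le).1 (by linarith)
    have hsub : ball x₀ r ∩ {x | r ^ 2 - ‖x - x₀‖ ^ 2 < τ} ⊆ ball x₀ r \ ball x₀ t := by
      rintro x ⟨hx1, hx2⟩
      refine ⟨hx1, fun hx3 => ?_⟩
      rw [mem_ball, dist_eq_norm] at hx3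
      have hx2 : r ^ 2 - ‖x - x₀‖ ^ 2 < τ := hx2
      nlinarith [norm_nonneg (x - x₀)]
    have hq1 : t / r ≤ 1 := (div_le_one hr).2 htr
    have hq0 : 0 ≤ t / r := by positivity
    have hq : 1 - t / r ≤ τ / r ^ 2 := by
      have : τ / r ^ 2 = 1 - (t / r) ^ 2 := by
        rw [div_pow, htτ]
        field_simp
        ring
      nlinarith
    have hbern : 1 + N * (t / r - 1) ≤ (t / r) ^ N := by
      have := one_add_mul_le_pow (a := t / r - 1) (by linarith) N
      simpa using this
    have htN : t ^ N = r ^ N * (t / r) ^ N := by rw [← mul_pow]; field_simp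
    calc volume.real (ball x₀ r ∩ {x | r ^ 2 - ‖x - x₀‖ ^ 2 < τ})
        ≤ volume.real (ball x₀ r \ ball x₀ t) :=
          measureReal_mono hsub (measure_ball_lt_top.trans_le' (measure_mono sdiff_subset)).ne
      _ = r ^ N * ω * (1 - (t / r) ^ N) := by
          rw [measureReal_sdiff (ball_subset_ball htr) measurableSet_ball, hvol r hr,
            hvol t ht0, htN]
          ring
      _ ≤ r ^ N * ω * ((N + 1) * (τ / r ^ 2)) := by
          gcongr
          have h1 : N * (1 - t / r) ≤ N * (τ / r ^ 2) := by gcongr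
          have h2 : 0 ≤ τ / r ^ 2 := by positivity
          linarith
      _ = r ^ N * ω * (N + 1) / r ^ 2 * τ := by ring

theorem exists_exp_le_add_mul_exp {c₁ A : ℝ} (hc₁ : 0 < c₁) (hA : 0 < A) (μ₁ c₀ : ℝ)
    (hμ₁ : 0 < μ₁) :
    ∃ C, 0 < C ∧ ∀ t ≤ c₀, Real.exp (A * t) ≤ c₁ + C * Real.exp (μ₁ * t) := by
  refine ⟨Real.exp (A * c₀) * Real.exp (-(μ₁ * (Real.log c₁ / A))), by positivity, fun t ht => ?_⟩
  rcases le_total (A * t) (Real.log c₁) with h | h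
  · have : Real.exp (A * t) ≤ c₁ := (Real.le_log_iff_exp_le hc₁).1 h
    have : 0 ≤ Real.exp (A * c₀) * Real.exp (-(μ₁ * (Real.log c₁ / A))) * Real.exp (μ₁ * t) := by
      positivity
    linarith
  · rw [← Real.exp_add, ← Real.exp_add]
    have h1 : Real.log c₁ / A ≤ t := by rwa [div_le_iff₀' hA]
    have : Real.exp (A * t) ≤ Real.exp (A * c₀ + -(μ₁ * (Real.log c₁ / A)) + μ₁ * t) := by
      rw [Real.exp_le_exp]
      nlinarith
    linarith

end Truncation

section LocalBound

variable {N : ℕ}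

theorem truncExp_ge {Ω : Set (EuclideanSpace ℝ (Fin N))} {K : ℝ} (hK : 0 < K)
    {u : EuclideanSpace ℝ (Fin N) → ℝ} {x : EuclideanSpace ℝ (Fin N)} (hx : x ∈ Ω)
    (hu : 2 ≤ u x) :
    (1 - Real.exp (-K)) ^ 3 * Real.exp (3 * K * (u x - 1)) ≤ truncExp Ω K u x := by
  rw [truncExp, indicator_of_mem hx,
    show 3 * K * (u x - 1) = (3 : ℕ) * (K * (u x - 1)) by push_cast; ring, Real.exp_nat_mul,
    ← mul_pow]
  have h0 : Real.exp (-K) ≤ 1 := Real.exp_le_one_iff.2 (by linarith)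
  have h1 : 1 ≤ Real.exp (-K) * Real.exp (K * (u x - 1)) := by
    rw [← Real.exp_add]
    exact Real.one_le_exp (by nlinarith)
  have h2 : 0 ≤ (1 - Real.exp (-K)) * Real.exp (K * (u x - 1)) :=
    mul_nonneg (by linarith) (Real.exp_pos _).le
  gcongr
  exact le_max_of_le_left (by linarith)

set_option maxHeartbeats 1000000 in
/-- At a point where `u` almost attains its supremum over a small ball, the value of `u` is
controlled by the weighted integral bound. -/
theorem exists_exp_mul_pow_le (x₀ xbar : EuclideanSpace ℝ (Fin N)) {r R K L μ₁ C₀ τ₀ : ℝ}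
    (c₀ : ℝ) (k : ℕ) (hr : 0 < r) (hR : 0 < R) (hK : 0 < K) (hL : 0 ≤ L) (hμ₁ : 0 < μ₁)
    (hC₀ : 0 ≤ C₀) (hτ₀ : 0 < τ₀) (hc₀ : 0 ≤ c₀) :
    ∃ θ C : ℝ, 0 < θ ∧ 0 ≤ C ∧ ∀ u : EuclideanSpace ℝ (Fin N) → ℝ,
      ContDiffOn ℝ 2 u (ball x₀ r) → ContinuousOn u (closure (ball x₀ r)) →
      (∀ x ∈ frontier (ball x₀ r), u x = 0) →
      (∀ x ∈ ball x₀ r ∩ ball xbar R, 1 < u x →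
        -lap u x ≤ L * (u x + 1) + K * ‖gradient u x‖ ^ 2) →
      (∀ τ, 0 < τ → τ ≤ τ₀ →
        IntegrableOn (fun x => Real.exp (μ₁ * u x))
          (ball xbar R ∩ {x | τ ≤ r ^ 2 - ‖x - x₀‖ ^ 2}) ∧
        ∫ x in ball xbar R ∩ {x | τ ≤ r ^ 2 - ‖x - x₀‖ ^ 2}, Real.exp (μ₁ * u x) ≤ C₀ / τ ^ k) →
      ∀ (x₁ : EuclideanSpace ℝ (Fin N)) (σ : ℝ), x₁ ∈ ball x₀ r → 2 ≤ u x₁ → 0 < σ → σ ≤ R →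
        ball x₁ σ ⊆ ball xbar R → σ ^ 2 * (u x₁ + 1) ≤ θ →
        (∀ x ∈ ball x₁ σ ∩ ball x₀ r, u x ≤ u x₁ + c₀) →
        Real.exp (μ₁ * u x₁) * σ ^ (N * (k + 1)) ≤ C := by
  obtain ⟨a, b, ha, hb, hmv⟩ := exists_sub_mean_value N
  obtain ⟨Cs, hCs, hshell⟩ := exists_volume_shell_le x₀ hr
  set κ := (1 - Real.exp (-K)) ^ 3 with hκ
  have hκ0 : 0 < κ := by
    have : Real.exp (-K) < 1 := Real.exp_lt_one_iff.2 (by linarith)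
    exact pow_pos (by linarith) 3
  set e₀ := Real.exp (3 * K * c₀) with he₀
  have he₀0 : 0 < e₀ := Real.exp_pos _
  set ω := volume.real (ball (0 : EuclideanSpace ℝ (Fin N)) 1) with hω
  have hω0 : 0 ≤ ω := measureReal_nonneg
  set c₁ := a * κ / (8 * (ω + 1)) with hc₁
  have hc₁0 : 0 < c₁ := by positivity
  obtain ⟨C, hC, hexp⟩ := exists_exp_le_add_mul_exp hc₁0 (by positivity : 0 < 3 * K) μ₁ c₀ hμ₁
  set c₄ := min (a * κ / (8 * (e₀ * Cs + 1))) (τ₀ / R ^ N) with hc₄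
  have hc₄0 : 0 < c₄ := lt_min (by positivity) (by positivity)
  have hc₄1 : c₄ * R ^ N ≤ τ₀ := by
    rw [← le_div_iff₀ (by positivity)]
    exact min_le_right _ _
  have hc₄2 : e₀ * Cs * c₄ ≤ a * κ / 8 := by
    have h1 : c₄ * (8 * (e₀ * Cs + 1)) ≤ a * κ := by
      rw [← le_div_iff₀ (by positivity)]
      exact min_le_left _ _
    linarith
  have hc₁1 : c₁ * ω ≤ a * κ / 8 := by
    have h1 : c₁ * (8 * (ω + 1)) = a * κ := by
      rw [hc₁]
      field_simp
    linarith
  set Λ := b * (3 * K * L * e₀ * (1 + c₀)) with hΛ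
  have hΛ0 : 0 ≤ Λ := by positivity
  refine ⟨a * κ / (2 * (Λ + 1)), 4 * C * C₀ / (a * κ * c₄ ^ k), by positivity, by positivity, ?_⟩
  intro u hu huc hu0 hdiff hint x₁ σ hx₁ hU hσ hσR hsub hσθ hcmp
  set U := u x₁ with hUdef
  set Bc := Real.exp (3 * K * (U - 1)) with hBc
  have hBc0 : 0 < Bc := Real.exp_pos _
  have hσN : 0 < σ ^ N := by positivity
  set V := truncExp (ball x₀ r) K u with hV
  obtain ⟨hV2, hVc, hVloc⟩ := contDiff_truncExp isOpen_ball isBounded_ball hK hu huc hu0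
  set K₁ := 3 * K * L * Real.exp (3 * K * (U + c₀ - 1)) * (U + c₀ + 1) with hK₁
  have hVx₁ : κ * Bc ≤ V x₁ := truncExp_ge hK hx₁ hU
  have hmain := hmv V hV2 hVc (truncExp_nonneg _ _ _) x₁ σ K₁ hσ fun x hx =>
    neg_le_lap_truncExp isOpen_ball isBounded_ball hK hL (by linarith) hu huc hu0 fun hxΩ =>
      ⟨hcmp x ⟨hx, hxΩ⟩, hdiff x ⟨hxΩ, hsub hx⟩⟩
  have hexpA : Real.exp (3 * K * (U + c₀ - 1)) = e₀ * Bc := by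
    rw [he₀, hBc, ← Real.exp_add]
    ring_nf
  have herr : b * K₁ * σ ^ 2 ≤ a * κ / 2 * Bc := by
    have h1 : b * K₁ * σ ^ 2 ≤ Λ * Bc * (σ ^ 2 * (U + 1)) := by
      have h2 : U + c₀ + 1 ≤ (1 + c₀) * (U + 1) := by nlinarith
      have h3 : 0 ≤ b * (3 * K * L * e₀) * Bc * σ ^ 2 := by positivity
      have h4 := mul_le_mul_of_nonneg_left h2 h3
      rw [hK₁, hexpA, hΛ]
      linarith
    have h5 : Λ * (σ ^ 2 * (U + 1)) ≤ a * κ / 2 := by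
      rw [le_div_iff₀ (by positivity)] at hσθ
      have : 0 ≤ σ ^ 2 * (U + 1) := mul_nonneg (by positivity) (by linarith)
      linarith
    have h6 := mul_le_mul_of_nonneg_right h5 hBc0.le
    linarith
  have hlow : a * κ / 2 * σ ^ N * Bc ≤ ∫ x in ball x₁ σ, V x := by
    have h1 := mul_le_mul_of_nonneg_left hVx₁ (by positivity : 0 ≤ a * σ ^ N)
    have h2 := mul_le_mul_of_nonneg_right herr hσN.le
    linarith
  set τ := c₄ * σ ^ N with hτ
  have hτ0 : 0 < τ := by positivity
  have hττ : τ ≤ τ₀ := by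
    refine le_trans ?_ hc₄1
    rw [hτ]
    gcongr
  obtain ⟨hI, hIle⟩ := hint τ hτ0 hττ
  set T := ball xbar R ∩ {x | τ ≤ r ^ 2 - ‖x - x₀‖ ^ 2} with hT
  set S := ball x₀ r ∩ {x | r ^ 2 - ‖x - x₀‖ ^ 2 < τ} with hS
  have hTm : MeasurableSet T :=
    measurableSet_ball.inter (measurableSet_le measurable_const (by fun_prop))
  have hSm : MeasurableSet S :=
    measurableSet_ball.inter (measurableSet_lt (by fun_prop) measurable_const)
  have hSfin : volume S ≠ ⊤ := (measure_ball_lt_top.trans_le' (measure_mono inter_subset_left)).ne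
  set J := Real.exp (-(μ₁ * U)) with hJ
  have hJ0 : 0 < J := Real.exp_pos _
  have hpt : ∀ x, (ball x₁ σ).indicator V x ≤
      ((ball x₁ σ).indicator (fun _ => c₁ * Bc) x + S.indicator (fun _ => e₀ * Bc) x) +
        T.indicator (fun x => C * Bc * J * Real.exp (μ₁ * u x)) x := by
    intro x
    have n1 : 0 ≤ (ball x₁ σ).indicator (fun _ => c₁ * Bc) x :=
      indicator_nonneg (fun _ _ => by positivity) x
    have n2 : 0 ≤ S.indicator (fun _ => e₀ * Bc) x :=
      indicator_nonneg (fun _ _ => by positivity) x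
    have n3 : 0 ≤ T.indicator (fun x => C * Bc * J * Real.exp (μ₁ * u x)) x :=
      indicator_nonneg (fun _ _ => by positivity) x
    by_cases hx : x ∈ ball x₁ σ
    · rw [indicator_of_mem hx]
      by_cases hxΩ : x ∈ ball x₀ r
      · have hxU := hcmp x ⟨hx, hxΩ⟩
        have h1 : V x ≤ Bc * Real.exp (3 * K * (u x - U)) := by
          refine (truncExp_le K u hxΩ).trans_eq ?_
          rw [hBc, ← Real.exp_add]
          ring_nf
        rcases lt_or_ge (r ^ 2 - ‖x - x₀‖ ^ 2) τ with h | h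
        · rw [indicator_of_mem (show x ∈ S from ⟨hxΩ, h⟩)]
          have h2 : Real.exp (3 * K * (u x - U)) ≤ e₀ := by
            rw [he₀]
            gcongr
            linarith
          have := mul_le_mul_of_nonneg_left h2 hBc0.le
          rw [mul_comm e₀]
          rw [mul_comm e₀] at n2
          linarith
        · rw [indicator_of_mem hx, indicator_of_mem (show x ∈ T from ⟨hsub hx, h⟩)]
          have h2 := mul_le_mul_of_nonneg_left (hexp (u x - U) (by linarith)) hBc0.le
          have h3 : Real.exp (μ₁ * (u x - U)) = J * Real.exp (μ₁ * u x) := by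
            rw [hJ, ← Real.exp_add]
            ring_nf
          rw [h3] at h2
          linarith
      · have : V x = 0 := indicator_of_notMem hxΩ _
        rw [this]
        positivity
    · rw [indicator_of_notMem hx]
      positivity
  have I0 : Integrable ((ball x₁ σ).indicator V) :=
    (hV2.continuous.integrable_of_hasCompactSupport hVc).indicator measurableSet_ball
  have I1 : Integrable ((ball x₁ σ).indicator fun _ => c₁ * Bc) :=
    (integrable_indicator_iff measurableSet_ball).2 (integrableOn_const measure_ball_lt_top.ne)
  have I2 : Integrable (S.indicator fun _ => e₀ * Bc) :=
    (integrable_indicator_iff hSm).2 (integrableOn_const hSfin)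
  have I3 : Integrable (T.indicator fun x => C * Bc * J * Real.exp (μ₁ * u x)) :=
    (integrable_indicator_iff hTm).2 (hI.const_mul _)
  have hvol : volume.real (ball x₁ σ) = σ ^ N * ω := by
    rw [Measure.real, Measure.addHaar_ball_of_pos volume x₁ hσ]
    simp [hω, Measure.real, hσ.le]
  have hup : ∫ x in ball x₁ σ, V x ≤
      (σ ^ N * ω * (c₁ * Bc) + Cs * τ * (e₀ * Bc)) + C * Bc * J * (C₀ / τ ^ k) := by
    rw [← integral_indicator measurableSet_ball]
    refine (integral_mono I0 ((I1.add I2).add I3) hpt).trans ?_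
    rw [integral_add' (I1.add I2) I3, integral_add' I1 I2, integral_indicator measurableSet_ball,
      integral_indicator hSm, integral_indicator hTm, setIntegral_const, setIntegral_const,
      integral_const_mul, hvol, smul_eq_mul, smul_eq_mul]
    have := hshell τ hτ0.le
    gcongr
  have hfin : a * κ / 4 * σ ^ N ≤ C * J * (C₀ / τ ^ k) := by
    have h1 := mul_le_mul_of_nonneg_right hc₁1 (by positivity : 0 ≤ σ ^ N * Bc)
    have h2 := mul_le_mul_of_nonneg_right hc₄2 (by positivity : 0 ≤ σ ^ N * Bc)
    have h3 : a * κ / 4 * σ ^ N * Bc ≤ C * J * (C₀ / τ ^ k) * Bc := by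
      rw [hτ] at hup ⊢
      linarith
    exact le_of_mul_le_mul_right h3 hBc0
  have hJU : J * Real.exp (μ₁ * U) = 1 := by
    rw [hJ, ← Real.exp_add]
    simp
  rw [le_div_iff₀ (by positivity)]
  have h4 := mul_le_mul_of_nonneg_right hfin
    (by positivity : 0 ≤ 4 * Real.exp (μ₁ * U) * (c₄ ^ k * σ ^ (N * k)))
  have h5 : C * J * (C₀ / τ ^ k) * (4 * Real.exp (μ₁ * U) * (c₄ ^ k * σ ^ (N * k))) =
      4 * C * C₀ * (J * Real.exp (μ₁ * U)) := by
    rw [hτ, mul_pow, ← pow_mul]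
    field_simp
  rw [h5, hJU] at h4
  have h6 : σ ^ (N * (k + 1)) = σ ^ N * σ ^ (N * k) := by rw [← pow_add]; ring_nf
  rw [h6]
  linarith

end LocalBound

section BoundaryBound

variable {N : ℕ}

theorem exp_le_of_exp_mul_sqrt_pow_le {μ₁ θ C U : ℝ} {n : ℕ} (hμ₁ : 0 < μ₁) (hθ : 0 < θ)
    (hU : 0 ≤ U) (h : Real.exp (μ₁ * U) * √(θ / (U + 1)) ^ n ≤ C) :
    Real.exp (μ₁ * U) ≤ C ^ 2 * n.factorial * Real.exp μ₁ / (μ₁ * θ) ^ n := by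
  have hX : 0 < Real.exp (μ₁ * U) := Real.exp_pos _
  have h1 : (Real.exp (μ₁ * U) * √(θ / (U + 1)) ^ n) ^ 2 ≤ C ^ 2 := by gcongr
  have h2 : (√(θ / (U + 1)) ^ n) ^ 2 = (θ / (U + 1)) ^ n := by
    rw [← pow_mul, mul_comm, pow_mul, Real.sq_sqrt (by positivity)]
  rw [mul_pow, h2, div_pow, mul_div_assoc', div_le_iff₀ (by positivity)] at h1
  have h3 : (μ₁ * (U + 1)) ^ n ≤ n.factorial * (Real.exp (μ₁ * U) * Real.exp μ₁) := by
    have := Real.pow_div_factorial_le_exp (μ₁ * (U + 1)) (by positivity) n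
    rw [div_le_iff₀ (by positivity)] at this
    rw [← Real.exp_add, show μ₁ * U + μ₁ = μ₁ * (U + 1) by ring]
    linarith
  rw [mul_pow] at h3
  rw [le_div_iff₀ (by positivity), mul_pow]
  have h4 := mul_le_mul_of_nonneg_left h1 (by positivity : 0 ≤ μ₁ ^ n)
  have h5 := mul_le_mul_of_nonneg_left h3 (by positivity : 0 ≤ C ^ 2)
  refine le_of_mul_le_mul_left ?_ hX
  linarith

theorem exists_boundary_bound (hN : 0 < N) (x₀ xbar : EuclideanSpace ℝ (Fin N))
    {r R K L μ₁ C₀ τ₀ : ℝ} (k : ℕ) (hr : 0 < r) (hR : 0 < R) (hK : 0 < K) (hL : 0 ≤ L)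
    (hμ₁ : 0 < μ₁) (hC₀ : 0 ≤ C₀) (hτ₀ : 0 < τ₀) :
    ∃ M : ℝ, 0 < M ∧ ∀ u : EuclideanSpace ℝ (Fin N) → ℝ,
      ContDiffOn ℝ 2 u (ball x₀ r) → ContinuousOn u (closure (ball x₀ r)) →
      (∀ x ∈ frontier (ball x₀ r), u x = 0) →
      (∀ x ∈ ball x₀ r ∩ ball xbar R, 1 < u x →
        -lap u x ≤ L * (u x + 1) + K * ‖gradient u x‖ ^ 2) →
      (∀ τ, 0 < τ → τ ≤ τ₀ →
        IntegrableOn (fun x => Real.exp (μ₁ * u x))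
          (ball xbar R ∩ {x | τ ≤ r ^ 2 - ‖x - x₀‖ ^ 2}) ∧
        ∫ x in ball xbar R ∩ {x | τ ≤ r ^ 2 - ‖x - x₀‖ ^ 2}, Real.exp (μ₁ * u x) ≤ C₀ / τ ^ k) →
      ∀ x ∈ ball xbar (R / 2) ∩ ball x₀ r, u x ≤ M := by
  set n := N * (k + 1) with hn
  have hn0 : n ≠ 0 := by positivity
  set c₀ := n * Real.log 2 / μ₁ with hc₀
  obtain ⟨θ, C, hθ, hC, hcore⟩ := exists_exp_mul_pow_le (N := N) x₀ xbar c₀ k hr hR hK hL hμ₁ hC₀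
    hτ₀ (by positivity)
  set C' := C ^ 2 * n.factorial * Real.exp μ₁ / (μ₁ * θ) ^ n with hC'
  have hC'0 : 0 ≤ C' := by positivity
  set Qm := Real.exp (μ₁ * 2) * R ^ n + 2 ^ n * C + C' * R ^ n with hQm
  have hQm0 : 0 < Qm := by positivity
  refine ⟨Qm / (R / 2) ^ n / μ₁, by positivity, fun u hu huc hu0 hdiff hint x hx => ?_⟩
  set Q : EuclideanSpace ℝ (Fin N) → ℝ := fun x => Real.exp (μ₁ * u x) * (R - dist x xbar) ^ n
    with hQ
  set T := closure (ball x₀ r) ∩ closedBall xbar R with hT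
  have hTc : IsCompact T := isBounded_ball.isCompact_closure.inter_right isClosed_closedBall
  have hxT : x ∈ T := ⟨subset_closure hx.2, ball_subset_closedBall
    (ball_subset_ball (by linarith) hx.1)⟩
  have hQc : ContinuousOn Q T :=
    ((continuousOn_const.mul (huc.mono inter_subset_left)).rexp).mul (by fun_prop)
  obtain ⟨x₁, hx₁, hmax⟩ := hTc.exists_isMaxOn ⟨x, hxT⟩ hQc
  have hQx : Real.exp (μ₁ * u x) * (R / 2) ^ n ≤ Q x₁ := by
    refine le_trans ?_ (hmax hxT)
    have h1 : dist x xbar < R / 2 := hx.1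
    simp only [hQ]
    gcongr
    linarith
  have hQpos : 0 < Q x₁ := lt_of_lt_of_le (by positivity) hQx
  set d := R - dist x₁ xbar with hd
  have hd0 : 0 < d := by
    have h1 : 0 ≤ d := sub_nonneg.2 hx₁.2
    rcases h1.eq_or_lt with h | h
    · simp [hQ, ← hd, ← h, hn0] at hQpos
    · exact h
  have hdR : d ≤ R := by linarith [dist_nonneg (x := x₁) (y := xbar)]
  have hQle : Q x₁ ≤ Qm := by
    rcases le_or_gt (u x₁) 2 with h2 | h2
    · have : Q x₁ ≤ Real.exp (μ₁ * 2) * R ^ n := by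
        simp only [hQ, ← hd]
        gcongr
      have : 0 ≤ 2 ^ n * C + C' * R ^ n := by positivity
      linarith
    · have hx₁Ω : x₁ ∈ ball x₀ r := by
        by_contra h
        have := hu0 x₁ (by rw [isOpen_ball.frontier_eq]; exact ⟨hx₁.1, h⟩)
        linarith
      set U := u x₁ with hU
      set σ := min (d / 2) √(θ / (U + 1)) with hσ
      have hσ0 : 0 < σ := lt_min (by positivity) (Real.sqrt_pos.2 (by positivity))
      have hσd : σ ≤ d / 2 := min_le_left _ _
      have hσθ : σ ^ 2 * (U + 1) ≤ θ := by
        rw [← le_div_iff₀ (by linarith)]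
        calc σ ^ 2 ≤ √(θ / (U + 1)) ^ 2 := by gcongr; exact min_le_right _ _
          _ = θ / (U + 1) := Real.sq_sqrt (by positivity)
      have hsub : ball x₁ σ ⊆ ball xbar R := ball_subset_ball' (by linarith)
      have hcmp : ∀ y ∈ ball x₁ σ ∩ ball x₀ r, u y ≤ U + c₀ := by
        intro y hy
        have h1 : dist y x₁ < σ := hy.1
        have h3 : d / 2 ≤ R - dist y xbar := by linarith [dist_triangle y x₁ xbar]
        have h4 : Q y ≤ Q x₁ :=
          hmax ⟨subset_closure hy.2, ball_subset_closedBall (hsub hy.1)⟩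
        have h5 : Real.exp (μ₁ * u y) * (d / 2) ^ n ≤ Real.exp (μ₁ * U) * d ^ n := by
          refine le_trans ?_ h4
          simp only [hQ]
          gcongr
        have h6 : Real.exp (μ₁ * u y) ≤ Real.exp (μ₁ * U) * 2 ^ n := by
          rw [div_pow, mul_div_assoc', div_le_iff₀ (by positivity)] at h5
          refine le_of_mul_le_mul_right ?_ (by positivity : 0 < d ^ n)
          linarith
        have h7 : Real.exp (μ₁ * U) * 2 ^ n = Real.exp (μ₁ * (U + c₀)) := by
          rw [hc₀, mul_add, Real.exp_add, mul_div_cancel₀ _ hμ₁.ne', Real.exp_nat_mul,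
            Real.exp_log two_pos]
        rw [h7, Real.exp_le_exp] at h6
        exact le_of_mul_le_mul_left h6 hμ₁
      have hfin := hcore u hu huc hu0 hdiff hint x₁ σ hx₁Ω h2.le hσ0 (by linarith) hsub hσθ hcmp
      rcases min_choice (d / 2) √(θ / (U + 1)) with h | h
      · rw [hσ, h, div_pow, mul_div_assoc', div_le_iff₀ (by positivity)] at hfin
        have h3 : Q x₁ ≤ C * 2 ^ n := hfin
        have : 0 ≤ Real.exp (μ₁ * 2) * R ^ n + C' * R ^ n := by positivity
        linarith
      · rw [hσ, h] at hfin
        have h3 := exp_le_of_exp_mul_sqrt_pow_le hμ₁ hθ (by linarith) hfin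
        have h4 : Q x₁ ≤ C' * R ^ n := by
          simp only [hQ, ← hd]
          gcongr
        have : 0 ≤ Real.exp (μ₁ * 2) * R ^ n + 2 ^ n * C := by positivity
        linarith
  rw [le_div_iff₀ hμ₁, le_div_iff₀ (by positivity)]
  have h1 := Real.add_one_le_exp (μ₁ * u x)
  have h2 := mul_le_mul_of_nonneg_right h1 (by positivity : 0 ≤ (R / 2) ^ n)
  have h3 : 0 < (R / 2) ^ n := by positivity
  linarith

end BoundaryBound

/-- Boundary local a priori bound (Lemma 4.4): near a boundary point
`x̄ ∈ Ω₊ ∩ ∂Ω`, solutions of `(P_λ)`, `λ ∈ [Λ₁, Λ₂]`, are uniformly bounded above. -/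
theorem stmt_3 {N : ℕ} (hN : 2 ≤ N) (x₀ : EuclideanSpace ℝ (Fin N)) (r : ℝ) (hr : 0 < r)
    (Ω : Set (EuclideanSpace ℝ (Fin N))) (hΩ : Ω = ball x₀ r)
    (cp cm h μ : EuclideanSpace ℝ (Fin N) → ℝ)
    (hcpc : ContinuousOn cp (closure Ω)) (hcmc : ContinuousOn cm (closure Ω))
    (hhc : ContinuousOn h (closure Ω)) (hμc : ContinuousOn μ Ω)
    (hμb : ∃ C : ℝ, ∀ x ∈ Ω, |μ x| ≤ C)
    (hcp0 : ∀ x ∈ Ω, 0 ≤ cp x) (hcm0 : ∀ x ∈ Ω, 0 ≤ cm x)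
    (hprod : ∀ x ∈ Ω, cp x * cm x = 0)
    (Ωp : Set (EuclideanSpace ℝ (Fin N))) (hΩp : Ωp = closure {x ∈ Ω | cp x ≠ 0})
    (hne : Ωp.Nonempty)
    (ε μ₁ : ℝ) (hε : 0 < ε) (hμ₁ : 0 < μ₁)
    (hnear : ∀ x ∈ Ω, infDist x Ωp < ε → μ₁ ≤ μ x ∧ cm x = 0)
    (xbar : EuclideanSpace ℝ (Fin N)) (hxbar : xbar ∈ Ωp ∩ frontier Ω) :
    ∀ Λ₁ Λ₂ : ℝ, 0 < Λ₁ → Λ₁ < Λ₂ →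
      ∃ R M : ℝ, 0 < R ∧ 0 < M ∧ ∀ lam ∈ Icc Λ₁ Λ₂,
        ∀ u : EuclideanSpace ℝ (Fin N) → ℝ,
          IsClassicalSolution Ω cp cm h μ lam u →
          ∀ x ∈ ball xbar R ∩ Ω, u x ≤ M := by
  intro Λ₁ Λ₂ hΛ₁ hΛ
  have hΛ₂ : 0 < Λ₂ := hΛ₁.trans hΛ
  have hΩo : IsOpen Ω := hΩ ▸ isOpen_ball
  have hcl : IsCompact (closure Ω) := by
    rw [hΩ]
    exact isBounded_ball.isCompact_closure
  obtain ⟨Cμ, hCμ⟩ := hμb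
  obtain ⟨Cp, hCp⟩ := hcl.exists_bound_of_continuousOn hcpc
  obtain ⟨H, hH⟩ := hcl.exists_bound_of_continuousOn hhc
  have hH0 : 0 ≤ H := (norm_nonneg _).trans (hH xbar hxbar.2.1)
  have hCp0 : 0 ≤ Cp := (norm_nonneg _).trans (hCp xbar hxbar.2.1)
  have hloc : ∀ x ∈ Ω, dist x xbar < ε → μ₁ ≤ μ x ∧ cm x = 0 := fun x hx hd =>
    hnear x hx ((infDist_le_dist_of_mem hxbar.1).trans_lt hd)
  have hxb0 : xbar ≠ x₀ := by
    rintro rfl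
    have := hxbar.2
    rw [hΩo.frontier_eq, hΩ] at this
    exact this.2 (mem_ball_self hr)
  -- a point of positivity of `cp` close to `xbar`
  obtain ⟨y, ⟨hyΩ, hycp⟩, hyd⟩ : ∃ y ∈ {x ∈ Ω | cp x ≠ 0},
      dist xbar y < min (ε / 4) (dist xbar x₀) := by
    have h1 := hxbar.1
    rw [hΩp, Metric.mem_closure_iff] at h1
    exact h1 _ (lt_min (by positivity) (dist_pos.2 hxb0))
  obtain ⟨hyε, hyx₀⟩ := lt_min_iff.1 hyd
  have hyne : y ≠ x₀ := by
    rintro rfl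
    exact lt_irrefl _ hyx₀
  have hycp0 : 0 < cp y := (hcp0 y hyΩ).lt_of_ne' hycp
  obtain ⟨ρ', hρ'0, hρ'⟩ : ∃ ρ' > 0, ball y ρ' ⊆ Ω ∩ {x | cp y / 2 < cp x} := by
    refine Metric.mem_nhds_iff.1 (Filter.inter_mem (hΩo.mem_nhds hyΩ) ?_)
    have : ContinuousAt cp y :=
      hcpc.continuousAt (Filter.mem_of_superset (hΩo.mem_nhds hyΩ) subset_closure)
    exact this.eventually (lt_mem_nhds (by linarith))
  set ρ₁ := min (ρ' / 2) (ε / 4) with hρ₁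
  have hρ₁0 : 0 < ρ₁ := by positivity
  have hρ₁ε : ρ₁ ≤ ε / 4 := min_le_right _ _
  have hρ₁ρ' : closedBall y ρ₁ ⊆ Ω ∩ {x | cp y / 2 < cp x} :=
    (closedBall_subset_ball ((min_le_left _ _).trans_lt (by linarith))).trans hρ'
  obtain ⟨k, C₀, τ₀, hτ₀, hC₀, hweight⟩ := exists_setIntegral_exp_le (R := 3 * ε / 8) (ρ := ε / 2)
    hr hρ₁0 (by linarith) (by positivity) (by linarith) hyne
    (fun x hx => hΩ ▸ (hρ₁ρ' hx).1) (Λ₂ * Cp) hμ₁ (by positivity : 0 < Λ₁ * (cp y / 2)) hH0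
  have hsub : ball xbar (ε / 8) ⊆ ball y (3 * ε / 8) := ball_subset_ball' (by linarith)
  obtain ⟨M, hM, hbound⟩ := exists_boundary_bound (by omega) x₀ xbar (R := ε / 8)
    (K := max Cμ 1) (L := Λ₂ * Cp + H) k hr (by positivity) (by positivity) (by positivity) hμ₁
    hC₀ hτ₀
  refine ⟨ε / 8 / 2, M, by positivity, hM, ?_⟩
  rintro lam ⟨hlam₁, hlam₂⟩ u ⟨hu, huc, -, hu0, heq⟩ x hx
  have hlam : 0 < lam := hΛ₁.trans_le hlam₁
  have hb : ∀ x ∈ Ω, lam * cp x ≤ Λ₂ * Cp := fun x hx => by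
    have := (le_abs_self _).trans (hCp x (subset_closure hx))
    have := hcp0 x hx
    gcongr
  have hbd := hweight u (hΩ ▸ hu) fun x hx => by
    have hxΩ : x ∈ Ω := hΩ ▸ hx.1
    have hxε : dist x xbar < ε := by
      have h1 : dist x y < ε / 2 := hx.2
      linarith [dist_triangle x y xbar, dist_comm xbar y]
    obtain ⟨h1, h2⟩ := hloc x hxΩ hxε
    refine ⟨lam * cp x, h x, mul_nonneg hlam.le (hcp0 x hxΩ), hb x hxΩ, hH x (subset_closure hxΩ),
      fun hxρ => ?_, ?_⟩
    · have : cp y / 2 < cp x := (hρ₁ρ' hxρ).2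
      gcongr
    · have h3 := heq x hxΩ
      rw [h2] at h3
      have h4 := mul_le_mul_of_nonneg_right h1 (sq_nonneg ‖gradient u x‖)
      linarith
  refine hbound u (hΩ ▸ hu) (hΩ ▸ huc) (hΩ ▸ hu0) ?_ ?_ x (hΩ ▸ hx)
  · intro z hz hz1
    have hzΩ : z ∈ Ω := hΩ ▸ hz.1
    have hzε : dist z xbar < ε := lt_of_lt_of_le hz.2 (by linarith)
    have h1 := heq z hzΩ
    rw [(hloc z hzΩ hzε).2] at h1
    have h2 : μ z ≤ max Cμ 1 := (le_abs_self _).trans ((hCμ z hzΩ).trans (le_max_left _ _))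
    have h3 := mul_le_mul_of_nonneg_right h2 (sq_nonneg ‖gradient u z‖)
    have h4 := (le_abs_self _).trans (hH z (subset_closure hzΩ))
    have h5 := mul_le_mul_of_nonneg_right (hb z hzΩ) (by linarith : 0 ≤ u z)
    have h6 : 0 ≤ H * u z := mul_nonneg hH0 (by linarith)
    have h7 : 0 ≤ Λ₂ * Cp := by positivity
    linarith
  · intro τ hτ hττ
    obtain ⟨h1, h2⟩ := hbd τ hτ hττ
    have hmono : ball xbar (ε / 8) ∩ {x | τ ≤ r ^ 2 - ‖x - x₀‖ ^ 2} ⊆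
        ball y (3 * ε / 8) ∩ {x | τ ≤ r ^ 2 - ‖x - x₀‖ ^ 2} := inter_subset_inter_left _ hsub
    refine ⟨h1.mono_set hmono, le_trans (setIntegral_mono_set h1 ?_ hmono.eventuallyLE) h2⟩
    exact Filter.Eventually.of_forall fun x => (Real.exp_pos _).le
end

section
/- Let N ≥ 2, let Ω ⊂ ℝ^N be a bounded domain, let c₊, c₋, h : cl(Ω) → ℝ be continuous with c₊ ≥ 0 and c₋ ≥ 0, and let μ : Ω → ℝ be continuous and bounded. Let x̄ ∈ Ω and R > 0 with cl(B_R(x̄)) ⊂ Ω, and assume c₋ ≡ 0 and μ ≥ 0 on B_R(x̄). Let u₀ be a classical solution of (P₀) such that c₊·u₀ ≥ 0 on B_R(x̄) and c₊·u₀ is not identically zero on B_R(x̄). Then there exists Λ̄ ∈ (0, ∞) such that for every λ ≥ Λ̄, problem (P_λ) admits no classical solution u satisfying u ≥ u₀ on B_R(x̄). -/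
open MeasureTheory Metric Set

section Calculus

variable {E : Type*} [NormedAddCommGroup E] [NormedSpace ℝ E]

lemma ContDiffAt.differentiableAt_fderiv_apply {f : E → ℝ} {x : E} (hf : ContDiffAt ℝ 2 f x)
    (e : E) : DifferentiableAt ℝ (fun y => fderiv ℝ f y e) x :=
  ((hf.fderiv_right (m := 1) (by norm_num)).differentiableAt (by norm_num)).clm_apply
    (differentiableAt_const e)

lemma ContDiffAt.eventually_differentiableAt {f : E → ℝ} {x : E} (hf : ContDiffAt ℝ 2 f x) :
    ∀ᶠ y in nhds x, DifferentiableAt ℝ f y :=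
  (hf.eventually (by simp)).mono fun _ hy => hy.differentiableAt (by norm_num)

lemma fderiv_fderiv_apply_sub {f g : E → ℝ} {x : E} (hf : ContDiffAt ℝ 2 f x)
    (hg : ContDiffAt ℝ 2 g x) (e : E) :
    fderiv ℝ (fun y => fderiv ℝ (fun z => f z - g z) y e) x e =
      fderiv ℝ (fun y => fderiv ℝ f y e) x e - fderiv ℝ (fun y => fderiv ℝ g y e) x e := by
  have h : (fun y => fderiv ℝ (fun z => f z - g z) y e) =ᶠ[nhds x]
      fun y => fderiv ℝ f y e - fderiv ℝ g y e := by
    filter_upwards [hf.eventually_differentiableAt, hg.eventually_differentiableAt] with y h1 h2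
    rw [fderiv_fun_sub h1 h2]
    rfl
  rw [h.fderiv_eq, fderiv_fun_sub (hf.differentiableAt_fderiv_apply e)
    (hg.differentiableAt_fderiv_apply e)]
  rfl

lemma fderiv_fderiv_apply_const_mul {f : E → ℝ} {x : E} (hf : ContDiffAt ℝ 2 f x) (c : ℝ)
    (e : E) :
    fderiv ℝ (fun y => fderiv ℝ (fun z => c * f z) y e) x e =
      c * fderiv ℝ (fun y => fderiv ℝ f y e) x e := by
  have h : (fun y => fderiv ℝ (fun z => c * f z) y e) =ᶠ[nhds x]
      fun y => c * fderiv ℝ f y e := by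
    filter_upwards [hf.eventually_differentiableAt] with y h1
    rw [fderiv_const_mul h1]
    rfl
  rw [h.fderiv_eq, fderiv_const_mul (hf.differentiableAt_fderiv_apply e)]
  rfl

lemma IsLocalMin.deriv_deriv_nonneg {g : ℝ → ℝ} {a : ℝ} (h : IsLocalMin g a)
    (hc : ContinuousAt g a) : 0 ≤ deriv (deriv g) a := by
  by_contra! hneg
  have hmax := isLocalMax_of_deriv_deriv_neg hneg h.deriv_eq_zero hc
  have heq : g =ᶠ[nhds a] fun _ => g a := by
    filter_upwards [h, hmax] with y h1 h2 using le_antisymm h2 h1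
  have h0 : deriv (deriv g) a = 0 := by
    rw [heq.deriv.deriv_eq]
    simp
  exact hneg.ne h0

lemma IsLocalMin.fderiv_fderiv_apply_nonneg {f : E → ℝ} {x : E} (h : IsLocalMin f x)
    (hf : ContDiffAt ℝ 2 f x) (e : E) : 0 ≤ fderiv ℝ (fun y => fderiv ℝ f y e) x e := by
  set l : ℝ → E := fun t => x + t • e with hl
  have hl0 : l 0 = x := by simp [hl]
  have hld (t : ℝ) : HasDerivAt l e t := by
    have h := ((hasDerivAt_id t).smul_const e).const_add x
    rwa [one_smul] at h
  have htends : Filter.Tendsto l (nhds 0) (nhds x) := hl0 ▸ (hld 0).continuousAt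
  have hmin : IsLocalMin (f ∘ l) 0 := by
    have := htends.eventually h
    filter_upwards [this] with t ht
    simpa [hl0] using ht
  have hderiv : deriv (f ∘ l) =ᶠ[nhds 0] fun t => fderiv ℝ f (l t) e := by
    filter_upwards [htends.eventually hf.eventually_differentiableAt] with t ht
    exact (ht.hasFDerivAt.comp_hasDerivAt t (hld t)).deriv
  have hsecond : deriv (deriv (f ∘ l)) 0 = fderiv ℝ (fun y => fderiv ℝ f y e) x e := by
    rw [hderiv.deriv_eq]
    have h1 := (hf.differentiableAt_fderiv_apply e).hasFDerivAt
    exact (HasFDerivAt.comp_hasDerivAt_of_eq 0 h1 (hld 0) hl0.symm).deriv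
  rw [← hsecond]
  exact hmin.deriv_deriv_nonneg
    (ContinuousAt.comp (by rw [hl0]; exact hf.continuousAt) (hld 0).continuousAt)

end Calculus

section Laplacian

variable {N : ℕ} {f g : EuclideanSpace ℝ (Fin N) → ℝ} {x : EuclideanSpace ℝ (Fin N)}

lemma lap_sub (hf : ContDiffAt ℝ 2 f x) (hg : ContDiffAt ℝ 2 g x) :
    lap (fun y => f y - g y) x = lap f x - lap g x := by
  simp only [lap, fderiv_fderiv_apply_sub hf hg, Finset.sum_sub_distrib]

lemma lap_const_mul (hf : ContDiffAt ℝ 2 f x) (c : ℝ) :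
    lap (fun y => c * f y) x = c * lap f x := by
  simp only [lap, fderiv_fderiv_apply_const_mul hf, Finset.mul_sum]

lemma IsLocalMin.lap_nonneg (h : IsLocalMin f x) (hf : ContDiffAt ℝ 2 f x) : 0 ≤ lap f x :=
  Finset.sum_nonneg fun _ _ => h.fderiv_fderiv_apply_nonneg hf _

/-- A function positive on the open ball of radius `r` around `x₀` and vanishing on its
boundary. -/
noncomputable def bump (x₀ : EuclideanSpace ℝ (Fin N)) (r : ℝ) (y : EuclideanSpace ℝ (Fin N)) :
    ℝ :=
  (r ^ 2 - ‖y - x₀‖ ^ 2) ^ 2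

variable (x₀ : EuclideanSpace ℝ (Fin N)) (r : ℝ)

lemma contDiff_bump : ContDiff ℝ 2 (bump x₀ r) := by
  have : ContDiff ℝ 2 fun y : EuclideanSpace ℝ (Fin N) => ‖y - x₀‖ ^ 2 :=
    (contDiff_id.sub contDiff_const).norm_sq ℝ
  exact (contDiff_const.sub this).pow 2

lemma hasFDerivAt_bump (y : EuclideanSpace ℝ (Fin N)) :
    HasFDerivAt (bump x₀ r) ((-4 * (r ^ 2 - ‖y - x₀‖ ^ 2)) • innerSL ℝ (y - x₀)) y := by
  have h := (((hasFDerivAt_id y).sub_const x₀).norm_sq.const_sub (r ^ 2)).pow 2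
  refine h.congr_fderiv ?_
  ext v
  simp
  ring

lemma fderiv_fderiv_bump (y e : EuclideanSpace ℝ (Fin N)) :
    fderiv ℝ (fun z => fderiv ℝ (bump x₀ r) z e) y e =
      8 * (inner ℝ (y - x₀) e) ^ 2 - 4 * (r ^ 2 - ‖y - x₀‖ ^ 2) * ‖e‖ ^ 2 := by
  have h : (fun z => fderiv ℝ (bump x₀ r) z e) =
      fun z => (-4 * (r ^ 2 - ‖z - x₀‖ ^ 2)) * inner ℝ (z - x₀) e := by
    funext z
    rw [(hasFDerivAt_bump x₀ r z).fderiv]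
    rfl
  have h1 := (((hasFDerivAt_id y).sub_const x₀).norm_sq.const_sub (r ^ 2)).const_mul (-4 : ℝ)
  have h2 := ((hasFDerivAt_id y).sub_const x₀).inner ℝ (hasFDerivAt_const e y)
  have h3 := (h1.mul h2).fderiv
  simp only [id] at h3
  rw [h]
  refine (congrArg (fun L : EuclideanSpace ℝ (Fin N) →L[ℝ] ℝ => L e) h3).trans ?_
  simp [inner_sub_left]
  ring

lemma lap_bump (y : EuclideanSpace ℝ (Fin N)) :
    lap (bump x₀ r) y = 8 * ‖y - x₀‖ ^ 2 - 4 * N * (r ^ 2 - ‖y - x₀‖ ^ 2) := by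
  have h : ‖y - x₀‖ ^ 2 = ∑ i, (inner ℝ (y - x₀) (EuclideanSpace.single i (1 : ℝ))) ^ 2 := by
    rw [EuclideanSpace.norm_sq_eq]
    simp [EuclideanSpace.inner_single_right]
  simp only [lap, fderiv_fderiv_bump, Finset.sum_sub_distrib, ← Finset.mul_sum, ← h]
  simp
  ring

end Laplacian

/-- The largest `k` for which `k * s ^ 2 ≤ -8 * ρ ^ 2 + C * s` can hold with `0 < s = r ^ 2 - ρ ^ 2`
is at most `(8 + C) ^ 2 / (32 * r ^ 2)`. -/
lemma le_of_bump_inequality {r s ρ C k : ℝ} (hr : 0 < r) (hs : 0 < s) (hρ : ρ ^ 2 = r ^ 2 - s)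
    (h : k * s ^ 2 ≤ -8 * ρ ^ 2 + C * s) : k ≤ (8 + C) ^ 2 / (32 * r ^ 2) := by
  rw [le_div_iff₀ (by positivity)]
  rw [hρ] at h
  have h1 : k * s ^ 2 * (32 * r ^ 2) ≤ (8 + C) ^ 2 * s ^ 2 := by
    nlinarith [sq_nonneg ((8 + C) * s - 16 * r ^ 2),
      mul_le_mul_of_nonneg_left h (by positivity : (0 : ℝ) ≤ 32 * r ^ 2)]
  have h2 : (k * (32 * r ^ 2)) * s ^ 2 ≤ (8 + C) ^ 2 * s ^ 2 := by linarith
  exact le_of_mul_le_mul_right h2 (by positivity)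

/-- At a local minimum of `m * (u - u₀) - bump x₀ r`, the gradient of `m * (u - u₀)` is that of
the bump. -/
lemma smul_gradient_sub_eq {N : ℕ} {u u₀ : EuclideanSpace ℝ (Fin N) → ℝ}
    {x x₀ : EuclideanSpace ℝ (Fin N)} {m r : ℝ} (hu : DifferentiableAt ℝ u x)
    (hu₀ : DifferentiableAt ℝ u₀ x)
    (hmin : IsLocalMin (fun y => m * (u y - u₀ y) - bump x₀ r y) x) :
    m • (gradient u x - gradient u₀ x) = (-4 * (r ^ 2 - ‖x - x₀‖ ^ 2)) • (x - x₀) := by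
  have h := hmin.hasFDerivAt_eq_zero
    (((hu.hasFDerivAt.sub hu₀.hasFDerivAt).const_mul m).sub (hasFDerivAt_bump x₀ r x))
  refine ext_inner_right ℝ fun v => ?_
  have hv := congrArg (fun L : EuclideanSpace ℝ (Fin N) →L[ℝ] ℝ => L v) (sub_eq_zero.mp h)
  simp only [inner_smul_left, inner_sub_left, gradient, InnerProductSpace.toDual_symm_apply]
  simpa [inner_sub_left] using hv

/-- Nonexistence for large `λ` (Lemma 5.1): if `u₀` solves `(P₀)` and `c₊ u₀ ⪈ 0`
on a ball `B_R(x̄)` where `c₋ ≡ 0` and `μ ≥ 0`, then for `λ` large `(P_λ)` has no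
solution `u ≥ u₀` on `B_R(x̄)`. -/
theorem stmt_4 {N : ℕ} (hN : 2 ≤ N) (Ω : Set (EuclideanSpace ℝ (Fin N)))
    (hΩo : IsOpen Ω) (hΩc : IsConnected Ω) (hΩb : Bornology.IsBounded Ω)
    (cp cm h μ : EuclideanSpace ℝ (Fin N) → ℝ)
    (hcpc : ContinuousOn cp (closure Ω)) (hcmc : ContinuousOn cm (closure Ω))
    (hhc : ContinuousOn h (closure Ω)) (hμc : ContinuousOn μ Ω)
    (hμb : ∃ C : ℝ, ∀ x ∈ Ω, |μ x| ≤ C)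
    (hcp0 : ∀ x ∈ Ω, 0 ≤ cp x) (hcm0 : ∀ x ∈ Ω, 0 ≤ cm x)
    (xbar : EuclideanSpace ℝ (Fin N)) (R : ℝ) (hR : 0 < R)
    (hball : closedBall xbar R ⊆ Ω)
    (hcmz : ∀ x ∈ ball xbar R, cm x = 0) (hμ0 : ∀ x ∈ ball xbar R, 0 ≤ μ x)
    (u₀ : EuclideanSpace ℝ (Fin N) → ℝ)
    (hu₀ : IsClassicalSolution Ω cp cm h μ 0 u₀)
    (hcpu₀ : ∀ x ∈ ball xbar R, 0 ≤ cp x * u₀ x)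
    (hcpu₀ne : ∃ x ∈ ball xbar R, cp x * u₀ x ≠ 0) :
    ∃ Λbar : ℝ, 0 < Λbar ∧ ∀ lam : ℝ, Λbar ≤ lam →
      ¬∃ u : EuclideanSpace ℝ (Fin N) → ℝ,
        IsClassicalSolution Ω cp cm h μ lam u ∧ ∀ x ∈ ball xbar R, u₀ x ≤ u x := by
  have hBΩ : ball xbar R ⊆ Ω := ball_subset_closedBall.trans hball
  obtain ⟨x₀, hx₀, hne⟩ := hcpu₀ne
  have hx₀Ω := hBΩ hx₀
  have hpos : 0 < cp x₀ * u₀ x₀ := lt_of_le_of_ne (hcpu₀ x₀ hx₀) hne.symm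
  have hcpx : 0 < cp x₀ := lt_of_le_of_ne (hcp0 x₀ hx₀Ω) (left_ne_zero_of_mul hne).symm
  have hu₀x : 0 < u₀ x₀ := (mul_pos_iff_of_pos_left hcpx).mp hpos
  have hC2 {u : EuclideanSpace ℝ (Fin N) → ℝ} (hu : ContDiffOn ℝ 2 u Ω)
      {x : EuclideanSpace ℝ (Fin N)} (hx : x ∈ Ω) : ContDiffAt ℝ 2 u x :=
    hu.contDiffAt (hΩo.mem_nhds hx)
  have hcpcont : ContinuousAt cp x₀ :=
    hcpc.continuousAt (Filter.mem_of_superset (hΩo.mem_nhds hx₀Ω) subset_closure)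
  have hu₀cont : ContinuousAt u₀ x₀ := (hC2 hu₀.1 hx₀Ω).continuousAt
  have hgradcont : ContinuousAt (gradient u₀) x₀ :=
    (LinearIsometryEquiv.continuous _).continuousAt.comp
      ((hC2 hu₀.1 hx₀Ω).fderiv_right (m := 1) (by norm_num)).continuousAt
  have hμcont : ContinuousAt μ x₀ := hμc.continuousAt (hΩo.mem_nhds hx₀Ω)
  have hdriftcont : ContinuousAt (fun x => ‖μ x • gradient u₀ x‖) x₀ :=
    (hμcont.smul hgradcont).norm
  set B := ‖μ x₀ • gradient u₀ x₀‖ + 1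
  have hev : ∀ᶠ x in nhds x₀, x ∈ ball xbar R ∧ cp x₀ / 2 < cp x ∧ u₀ x₀ / 2 < u₀ x ∧
      ‖μ x • gradient u₀ x‖ < B :=
    Filter.Eventually.and (isOpen_ball.mem_nhds hx₀) <|
      (hcpcont.eventually_const_lt (half_lt_self hcpx)).and <|
      (hu₀cont.eventually_const_lt (half_lt_self hu₀x)).and <|
      hdriftcont.eventually_lt_const (lt_add_one _)
  obtain ⟨r, hr, hrsub⟩ := nhds_basis_closedBall.eventually_iff.mp hev
  set K := (8 + (4 * N + 8 * B * r)) ^ 2 / (32 * r ^ 2)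
  have hK0 : 0 ≤ K := by positivity
  refine ⟨(K + 1) / (cp x₀ / 2), by positivity, ?_⟩
  rintro lam hlam ⟨u, hu, hle⟩
  have hlam0 : 0 < lam := lt_of_lt_of_le (by positivity) hlam
  have hlamK : K + 1 ≤ lam * (cp x₀ / 2) := (div_le_iff₀ (by positivity)).mp hlam
  set d := u₀ x₀ / 2
  have hd0 : 0 < d := by positivity
  have hW : ∀ x ∈ closedBall x₀ r, 0 < u x - u₀ x + d := fun x hx => by
    linarith [hle x (hrsub hx).1]
  have hWcont : ContinuousOn (fun x => u x - u₀ x + d) (closedBall x₀ r) := fun x hx =>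
    (((hC2 hu.1 (hBΩ (hrsub hx).1)).continuousAt.sub
      (hC2 hu₀.1 (hBΩ (hrsub hx).1)).continuousAt).add continuousAt_const).continuousWithinAt
  obtain ⟨x, hx, hmax⟩ := (isCompact_closedBall x₀ r).exists_isMaxOn
    ⟨x₀, mem_closedBall_self hr.le⟩
    ((contDiff_bump x₀ r).continuous.continuousOn.div hWcont fun x hx => (hW x hx).ne')
  set m := bump x₀ r x / (u x - u₀ x + d)
  have hm0 : 0 < m := by
    have h1 : bump x₀ r x₀ / (u x₀ - u₀ x₀ + d) ≤ m := hmax (mem_closedBall_self hr.le)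
    refine lt_of_lt_of_le (div_pos ?_ (hW x₀ (mem_closedBall_self hr.le))) h1
    have h2 : bump x₀ r x₀ = (r ^ 2) ^ 2 := by simp [bump]
    rw [h2]
    positivity
  have hmx : m * (u x - u₀ x + d) = bump x₀ r x := div_mul_cancel₀ _ (hW x hx).ne'
  have hnorm : ‖x - x₀‖ ≤ r := by simpa [dist_eq_norm] using hx
  set s := r ^ 2 - ‖x - x₀‖ ^ 2 with hs
  have hbx : bump x₀ r x = s ^ 2 := rfl
  have hs0 : 0 < s := by
    have h1 : 0 ≤ s := sub_nonneg.mpr (by gcongr)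
    refine lt_of_le_of_ne h1 fun h2 => ?_
    have := mul_pos hm0 (hW x hx)
    rw [hmx, hbx, ← h2] at this
    norm_num at this
  have hxball : x ∈ ball x₀ r := by
    rw [mem_ball, dist_eq_norm]
    exact lt_of_pow_lt_pow_left₀ 2 hr.le (sub_pos.mp hs0)
  obtain ⟨hxR, hcpx', hu₀x', hdrift⟩ := hrsub hx
  have hxΩ := hBΩ hxR
  have hux := hC2 hu.1 hxΩ
  have hu₀x := hC2 hu₀.1 hxΩ
  have hmin : IsLocalMin (fun y => m * (u y - u₀ y) - bump x₀ r y) x := by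
    filter_upwards [isOpen_ball.mem_nhds hxball] with y hy
    have hy' := ball_subset_closedBall hy
    have h1 : bump x₀ r y / (u y - u₀ y + d) ≤ m := hmax hy'
    rw [div_le_iff₀ (hW y hy')] at h1
    linarith
  have hgrad := smul_gradient_sub_eq (hux.differentiableAt (by norm_num))
    (hu₀x.differentiableAt (by norm_num)) hmin
  have hlap := hmin.lap_nonneg ((contDiffAt_const.mul (hux.sub hu₀x)).sub
    (contDiff_bump x₀ r).contDiffAt)
  rw [lap_sub (contDiffAt_const.mul (hux.sub hu₀x)) (contDiff_bump x₀ r).contDiffAt,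
    lap_const_mul (hux.sub hu₀x), lap_sub hux hu₀x, lap_bump, ← hs] at hlap
  have hequ := hu.2.2.2.2 x hxΩ
  have hequ₀ := hu₀.2.2.2.2 x hxΩ
  rw [hcmz x hxR] at hequ hequ₀
  have hsq : ‖gradient u x‖ ^ 2 = ‖gradient u₀ x‖ ^ 2
      + 2 * inner ℝ (gradient u₀ x) (gradient u x - gradient u₀ x)
      + ‖gradient u x - gradient u₀ x‖ ^ 2 := by
    rw [← norm_add_sq_real, add_sub_cancel]
  have hinner : -(4 * s * (B * r)) ≤
      m * (μ x * inner ℝ (gradient u₀ x) (gradient u x - gradient u₀ x)) := by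
    have h1 : m * (μ x * inner ℝ (gradient u₀ x) (gradient u x - gradient u₀ x)) =
        -(4 * s * inner ℝ (μ x • gradient u₀ x) (x - x₀)) := by
      calc _ = inner ℝ (μ x • gradient u₀ x) (m • (gradient u x - gradient u₀ x)) := by
            rw [real_inner_smul_left, real_inner_smul_right]; ring
        _ = _ := by rw [hgrad, real_inner_smul_right]; ring
    rw [h1]
    have h2 : inner ℝ (μ x • gradient u₀ x) (x - x₀) ≤ B * r :=
      (real_inner_le_norm _ _).trans (by gcongr)
    gcongr
  have hreact : (K + 1) * (u x - u₀ x + d) ≤ lam * cp x * u x := by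
    have h0 := hW x hx
    calc (K + 1) * (u x - u₀ x + d) ≤ lam * cp x * (u x - u₀ x + d) := by
          refine mul_le_mul_of_nonneg_right (hlamK.trans ?_) h0.le
          gcongr
      _ ≤ lam * cp x * u x := by
          have : 0 < cp x := lt_trans (by positivity) hcpx'
          gcongr
          linarith
  have hkey : (K + 1) * s ^ 2 ≤ -8 * ‖x - x₀‖ ^ 2 + (4 * N + 8 * B * r) * s := by
    have h1 : m * ((K + 1) * (u x - u₀ x + d)) = (K + 1) * s ^ 2 := by
      rw [← hbx, ← hmx]; ring
    have h2 := mul_le_mul_of_nonneg_left hreact hm0.le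
    have h3 : 0 ≤ m * (μ x * ‖gradient u x - gradient u₀ x‖ ^ 2) :=
      mul_nonneg hm0.le (mul_nonneg (hμ0 x hxR) (sq_nonneg _))
    have h4 : lap u x - lap u₀ x = -(lam * cp x * u x
        + 2 * (μ x * inner ℝ (gradient u₀ x) (gradient u x - gradient u₀ x))
        + μ x * ‖gradient u x - gradient u₀ x‖ ^ 2) := by
      rw [hsq] at hequ
      linear_combination hequ₀ - hequ
    rw [h4] at hlap
    linarith
  have := le_of_bump_inequality hr hs0 (by rw [hs]; ring) hkey
  linarith
end
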